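/- arXiv:1701.01208 — 3 statements merged into one kernel-verified Lean document; each statement's English description precedes it below -/
import Mathlib

section
/- Let k, m ≥ 3 and l ≥ 1 be integers with gcd(m, l) = 1. Let T be the simple graph whose vertex set is the quotient group ℤ²/Λ, where Λ is the subgroup of ℤ² generated by (k,0) and (l,m), and in which two classes are adjacent if and only if they are distinct and their difference is the class of (1,0), (−1,0), (0,1) or (0,−1). Then T is isomorphic to the circulant graph C_{km}(l, m). -/
open SimpleGraph

/-- The circulant graph `C_n(s)` on `ZMod n`: distinct `i, j` are adjacent iff
`i - j ≡ a` or `j - i ≡ a (mod n)` for some `a ∈ s`. -/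
def circulant (n : ℕ) (s : Set ℤ) : SimpleGraph (ZMod n) :=
  SimpleGraph.fromRel (fun i j => ∃ a ∈ s, i - j = (a : ZMod n))

/-- The toroidal grid graph on the quotient of `ℤ × ℤ` by the subgroup generated by
`(a, b)` and `(c, d)`: distinct classes are adjacent iff their difference is the class
of `(1,0)`, `(-1,0)`, `(0,1)` or `(0,-1)`. -/
def torusGrid (a b c d : ℤ) :
    SimpleGraph ((ℤ × ℤ) ⧸ AddSubgroup.closure {(a, b), (c, d)}) :=
  SimpleGraph.fromRel (fun x y =>
    x - y = QuotientAddGroup.mk ((1 : ℤ), (0 : ℤ)) ∨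
    x - y = QuotientAddGroup.mk ((0 : ℤ), (1 : ℤ)))

/-- The homomorphism `(x, y) ↦ m x - l y` from `ℤ × ℤ` to `ZMod n`. -/
def skewHom (n : ℕ) (l m : ℤ) : ℤ × ℤ →+ ZMod n :=
  (Int.castAddHom (ZMod n)).comp
    (AddMonoidHom.mk' (fun p : ℤ × ℤ => m * p.1 - l * p.2) fun p q => by
      simp only [Prod.fst_add, Prod.snd_add]; ring)

lemma skewHom_apply (n : ℕ) (l m : ℤ) (p : ℤ × ℤ) :
    skewHom n l m p = ((m * p.1 - l * p.2 : ℤ) : ZMod n) := rfl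

lemma skewHom_surjective (n : ℕ) {l m : ℤ} (h : IsCoprime m l) :
    Function.Surjective (skewHom n l m) := by
  intro z
  obtain ⟨w, rfl⟩ := ZMod.intCast_surjective z
  obtain ⟨a, b, hab⟩ := h
  refine ⟨(w * a, -(w * b)), ?_⟩
  rw [skewHom_apply]
  congr 1
  linear_combination w * hab

lemma closure_eq_ker_skewHom {k m : ℕ} {l : ℤ} (hm : m ≠ 0) (h : IsCoprime (m : ℤ) l) :
    AddSubgroup.closure {((k : ℤ), (0 : ℤ)), (l, (m : ℤ))} = (skewHom (k * m) l m).ker := by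
  apply le_antisymm
  · rw [AddSubgroup.closure_le]
    rintro p (rfl | rfl) <;>
      simp only [SetLike.mem_coe, AddMonoidHom.mem_ker, skewHom_apply,
        ZMod.intCast_zmod_eq_zero_iff_dvd]
    · exact ⟨1, by push_cast; ring⟩
    · exact ⟨0, by ring⟩
  · rintro ⟨x, y⟩ hp
    rw [AddMonoidHom.mem_ker, skewHom_apply, ZMod.intCast_zmod_eq_zero_iff_dvd] at hp
    obtain ⟨t, ht⟩ := hp
    push_cast at ht
    obtain ⟨s, rfl⟩ : (m : ℤ) ∣ y :=
      h.dvd_of_dvd_mul_left ⟨x - k * t, by linear_combination -ht⟩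
    have hx : x = t * k + s * l :=
      mul_left_cancel₀ (Int.natCast_ne_zero.mpr hm) (by linear_combination ht)
    rw [AddSubgroup.mem_closure_pair]
    exact ⟨t, s, by ext <;> simp [hx, mul_comm]⟩

/-- The skew toroidal grid indexed by `(k,0)` and `(l,m)` with `gcd(m,l) = 1` is
isomorphic to the circulant graph `C_{km}(l, m)`. -/
theorem skew_torus_iso_circulant (k m l : ℕ) (hk : 3 ≤ k) (hm : 3 ≤ m) (hl : 1 ≤ l)
    (hgcd : Nat.gcd m l = 1) :
    Nonempty (torusGrid (k : ℤ) 0 (l : ℤ) (m : ℤ) ≃g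
      circulant (k * m) {(l : ℤ), (m : ℤ)}) := by
  have hcop : IsCoprime (m : ℤ) (l : ℤ) := Nat.isCoprime_iff_coprime.mpr hgcd
  let e : ((ℤ × ℤ) ⧸ AddSubgroup.closure {((k : ℤ), (0 : ℤ)), ((l : ℤ), (m : ℤ))}) ≃+
      ZMod (k * m) :=
    QuotientAddGroup.liftEquiv _ (skewHom_surjective _ hcop)
      (closure_eq_ker_skewHom (by omega) hcop)
  have he (p : ℤ × ℤ) : e (QuotientAddGroup.mk p) = skewHom (k * m) l m p := rfl
  have h₁ (x y) : x - y = QuotientAddGroup.mk ((1 : ℤ), (0 : ℤ)) ↔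
      e x - e y = (m : ZMod (k * m)) := by
    rw [← e.injective.eq_iff, map_sub, he, skewHom_apply]
    simp
  have h₂ (x y) : x - y = QuotientAddGroup.mk ((0 : ℤ), (1 : ℤ)) ↔
      e y - e x = (l : ZMod (k * m)) := by
    rw [← e.injective.eq_iff, map_sub, he, skewHom_apply, ← neg_sub (e y), neg_eq_iff_eq_neg]
    simp
  refine ⟨⟨e.toEquiv, ?_⟩⟩
  intro x y
  simp only [torusGrid, circulant, fromRel_adj, h₁, h₂, Set.mem_insert_iff,
    Set.mem_singleton_iff, exists_eq_or_imp, exists_eq_left, Int.cast_natCast,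
    AddEquiv.toEquiv_eq_coe, EquivLike.coe_coe, ne_eq, e.injective.eq_iff]
  tauto
end

section
/- Let k, m ≥ 3 be integers with gcd(k, m) = 1. Then the box (Cartesian) product γ_k □ γ_m of cycle graphs is isomorphic to the circulant graph C_{km}(k, m). -/
open SimpleGraph

/-- The cycle graph on `ZMod n`: distinct `i, j` are adjacent iff `i - j = ±1`. -/
def cycleGraph' (n : ℕ) : SimpleGraph (ZMod n) :=
  SimpleGraph.fromRel (fun i j => i - j = 1)

/-- For coprime `k, m`, the bijection `(a, b) ↦ m a + k b` from `ZMod k × ZMod m` to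
`ZMod (k * m)`, built from the Chinese remainder isomorphism. -/
noncomputable def gridEquiv {k m : ℕ} (h : k.Coprime m) : ZMod k × ZMod m ≃ ZMod (k * m) :=
  ((ZMod.unitOfCoprime m h.symm).mulLeft.prodCongr (ZMod.unitOfCoprime k h).mulLeft).trans
    (ZMod.chineseRemainder h).symm.toEquiv

theorem chineseRemainder_gridEquiv {k m : ℕ} (h : k.Coprime m) (x : ZMod k × ZMod m) :
    ZMod.chineseRemainder h (gridEquiv h x) = ((m : ZMod k) * x.1, (k : ZMod m) * x.2) := by
  simp [gridEquiv, Prod.map]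

theorem gridEquiv_sub_eq_iff {k m : ℕ} (h : k.Coprime m) (x y : ZMod k × ZMod m)
    (z : ZMod (k * m)) :
    gridEquiv h x - gridEquiv h y = z ↔
      ((m : ZMod k) * (x.1 - y.1), (k : ZMod m) * (x.2 - y.2)) = ZMod.chineseRemainder h z := by
  rw [← (ZMod.chineseRemainder h).injective.eq_iff, map_sub, chineseRemainder_gridEquiv,
    chineseRemainder_gridEquiv, Prod.mk_sub_mk, mul_sub, mul_sub]

theorem gridEquiv_sub_eq_left {k m : ℕ} (h : k.Coprime m) (x y : ZMod k × ZMod m) :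
    gridEquiv h x - gridEquiv h y = k ↔ x.1 = y.1 ∧ x.2 - y.2 = 1 := by
  have hm : IsUnit (m : ZMod k) := (ZMod.unitOfCoprime m h.symm).isUnit
  have hk : IsUnit (k : ZMod m) := (ZMod.unitOfCoprime k h).isUnit
  rw [gridEquiv_sub_eq_iff, map_natCast, Prod.ext_iff]
  simp [hm.mul_right_eq_zero, hk.mul_eq_left, sub_eq_zero]

theorem gridEquiv_sub_eq_right {k m : ℕ} (h : k.Coprime m) (x y : ZMod k × ZMod m) :
    gridEquiv h x - gridEquiv h y = m ↔ x.1 - y.1 = 1 ∧ x.2 = y.2 := by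
  have hm : IsUnit (m : ZMod k) := (ZMod.unitOfCoprime m h.symm).isUnit
  have hk : IsUnit (k : ZMod m) := (ZMod.unitOfCoprime k h).isUnit
  rw [gridEquiv_sub_eq_iff, map_natCast, Prod.ext_iff]
  simp [hk.mul_right_eq_zero, hm.mul_eq_left, sub_eq_zero]

/-- For `gcd(k,m) = 1`, the box product of cycles `γ_k □ γ_m` (the non-skew toroidal
grid indexed by `(k,0)` and `(0,m)`) is isomorphic to the circulant graph `C_{km}(k,m)`. -/
theorem boxProd_cycles_iso_circulant (k m : ℕ) (hk : 3 ≤ k) (hm : 3 ≤ m)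
    (hgcd : Nat.gcd k m = 1) :
    Nonempty ((cycleGraph' k).boxProd (cycleGraph' m) ≃g
      circulant (k * m) {(k : ℤ), (m : ℤ)}) := by
  refine ⟨⟨gridEquiv hgcd, fun {x y} => ?_⟩⟩
  simp only [circulant, cycleGraph', boxProd_adj, fromRel_adj, Set.mem_insert_iff,
    Set.mem_singleton_iff, exists_eq_or_imp, exists_eq_left, Int.cast_natCast,
    gridEquiv_sub_eq_left, gridEquiv_sub_eq_right, (gridEquiv hgcd).injective.ne_iff,
    ne_eq, Prod.ext_iff, eq_comm (a := y.1) (b := x.1), eq_comm (a := y.2) (b := x.2)]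
  tauto
end

section
/- Let k ≥ 3 be an integer and let v be any vertex of the box product γ_k □ γ_3 of a k-cycle and a 3-cycle. Let G be the graph obtained from γ_k □ γ_3 by deleting v (the decompleted toroidal grid constructed from 3-cycles, which has 3k − 1 ≥ 8 vertices). Then the number of points x ∈ 𝔽₂^{E(G)} with Ψ_G(x) = 0 is congruent to 0 modulo 8; equivalently, c₂^{(2)}(G) = 0. -/
open SimpleGraph
open scoped Classical

/-- `T` is (the edge set of) a spanning tree of `G`. -/
def IsSpanningTree {V : Type} (G : SimpleGraph V) (T : Set (Sym2 V)) : Prop :=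
  T ⊆ G.edgeSet ∧ (SimpleGraph.fromEdgeSet T).Connected ∧
    (SimpleGraph.fromEdgeSet T).IsAcyclic

/-- The Kirchhoff polynomial `Ψ_G = Σ_T ∏_{e ∉ T} α_e`, summed over spanning trees. -/
noncomputable def kirchhoff {V : Type} [Fintype V] (G : SimpleGraph V) :
    MvPolynomial G.edgeSet ℤ :=
  ∑ T ∈ G.edgeFinset.powerset.filter
      (fun T : Finset (Sym2 V) => IsSpanningTree G (T : Set (Sym2 V))),
    ∏ e : G.edgeSet, if (e : Sym2 V) ∈ T then 1 else MvPolynomial.X e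

/-- `[Ψ_G]_p`: the number of points `x ∈ 𝔽_p^{E(G)}` with `Ψ_G(x) = 0`. -/
noncomputable def zeroCount {V : Type} [Fintype V] (G : SimpleGraph V) (p : ℕ) : ℕ :=
  Nat.card {x : G.edgeSet → ZMod p //
    MvPolynomial.eval x (MvPolynomial.map (Int.castRingHom (ZMod p)) (kirchhoff G)) = 0}

set_option linter.unusedSectionVars false

section ZModTwoDeterminants

open Matrix

variable {n m : Type*} [Fintype n] [DecidableEq n] [Fintype m] [DecidableEq m]

/-- Over `ZMod 2`, a determinant is determined by whether the kernel is trivial. -/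
lemma det_eq_det_of_ker_iff {A : Matrix n n (ZMod 2)} {B : Matrix m m (ZMod 2)}
    (h : (∀ w, A *ᵥ w = 0 → w = 0) ↔ (∀ w, B *ᵥ w = 0 → w = 0)) : A.det = B.det := by
  have key : A.det = 0 ↔ B.det = 0 := by
    rw [← exists_mulVec_eq_zero_iff, ← exists_mulVec_eq_zero_iff]
    simp only [ne_eq, and_comm (a := ¬ _), ← Classical.not_imp, ← not_forall]
    exact not_congr h
  generalize A.det = a at key
  generalize B.det = b at key
  revert a b
  decide

lemma det_eq_det_of_mulVec_iff {A B : Matrix n n (ZMod 2)}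
    (h : ∀ w, A *ᵥ w = 0 ↔ B *ᵥ w = 0) : A.det = B.det :=
  det_eq_det_of_ker_iff (by simp only [h])

lemma det_eq_one_iff {A : Matrix n n (ZMod 2)} :
    A.det = 1 ↔ ∀ w, A *ᵥ w = 0 → w = 0 := by
  have h : A.det = 1 ↔ ¬ A.det = 0 := by
    generalize A.det = a
    revert a
    decide
  rw [h, ← exists_mulVec_eq_zero_iff]
  push Not
  exact forall_congr' fun w => not_imp_not

variable {R : Type*} [CommRing R]

lemma updateRow_updateRow_swap_det (M : Matrix n n R) {a b : n} (hab : a ≠ b) (u w : n → R) :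
    ((M.updateRow a u).updateRow b w).det = -((M.updateRow a w).updateRow b u).det := by
  have h : ((M.updateRow a (u + w)).updateRow b (u + w)).det = 0 :=
    det_zero_of_row_eq hab (by simp [updateRow_ne hab])
  have h0 : ∀ u, ((M.updateRow a u).updateRow b u).det = 0 := fun u =>
    det_zero_of_row_eq hab (by simp [updateRow_ne hab])
  rw [det_updateRow_add, updateRow_comm _ hab, updateRow_comm _ hab, det_updateRow_add,
    det_updateRow_add, updateRow_comm _ hab.symm, updateRow_comm _ hab.symm,
    updateRow_comm _ hab.symm, updateRow_comm _ hab.symm, h0, h0] at h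
  linear_combination h

/-- The Desnanot–Jacobi identity, in terms of row replacements. -/
lemma det_mul_det_updateRow_updateRow (M : Matrix n n R) {a b : n} (hab : a ≠ b) (u w : n → R) :
    M.det * ((M.updateRow a u).updateRow b w).det =
      (M.updateRow a u).det * (M.updateRow b w).det -
        (M.updateRow a w).det * (M.updateRow b u).det := by
  have hw : M.det • w = ∑ i, (M.updateRow i w).det • M i := by
    have h := mulVec_cramer Mᵀ w
    rw [det_transpose] at h
    rw [← h]
    ext j
    simp only [mulVec, dotProduct, cramer_transpose_apply, Finset.sum_apply, Pi.smul_apply,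
      smul_eq_mul, transpose_apply]
    exact Finset.sum_congr rfl fun i _ => mul_comm _ _
  have hlin : ∀ c : n → R, ((M.updateRow a u).updateRow b (∑ i, c i • M i)).det =
      ∑ i, c i * ((M.updateRow a u).updateRow b (M i)).det := by
    intro c
    have := map_sum ((detRowAlternating (R := R) (n := n)).toMultilinearMap.toLinearMap
      (M.updateRow a u) b) (fun i => c i • M i) Finset.univ
    simp only [map_smul, smul_eq_mul] at this
    exact this
  rw [← det_updateRow_smul, hw, hlin, ← Finset.add_sum_erase _ _ (Finset.mem_univ b),
    ← Finset.add_sum_erase _ _ (Finset.mem_erase.2 ⟨hab, Finset.mem_univ a⟩),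
    Finset.sum_eq_zero]
  · rw [updateRow_updateRow_swap_det M hab u (M a), updateRow_eq_self,
      show (M.updateRow a u).updateRow b (M b) = M.updateRow a u by
        rw [updateRow_comm _ hab, updateRow_eq_self]]
    ring
  · intro i hi
    simp only [Finset.mem_erase, Finset.mem_univ, and_true] at hi
    have h0 : ((M.updateRow a u).updateRow b (M i)).det = 0 :=
      det_zero_of_row_eq hi.2 (by simp [updateRow_ne hi.1, updateRow_ne hi.2])
    rw [h0, mul_zero]

/-- Three functionals which agree on a common kernel vector of the matrix satisfy a cocycle
relation. -/
lemma det_updateRow_updateRow_cocycle {M : Matrix n n (ZMod 2)} {k : n → ZMod 2} (hk : k ≠ 0)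
    (hM : M *ᵥ k = 0) {a b : n} (hab : a ≠ b) {u v w : n → ZMod 2}
    (huw : u ⬝ᵥ k = w ⬝ᵥ k) (hvw : v ⬝ᵥ k = w ⬝ᵥ k) :
    ((M.updateRow a u).updateRow b v).det =
      ((M.updateRow a u).updateRow b w).det + ((M.updateRow a w).updateRow b v).det := by
  have h : ((M.updateRow a (u + w)).updateRow b (v + w)).det = 0 := by
    refine exists_mulVec_eq_zero_iff.1 ⟨k, hk, ?_⟩
    rw [updateRow_mulVec, updateRow_mulVec, hM, add_dotProduct, add_dotProduct, huw, hvw,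
      CharTwo.add_self_eq_zero]
    simp
  have h0 : ((M.updateRow a w).updateRow b w).det = 0 :=
    det_zero_of_row_eq hab (by simp [updateRow_ne hab])
  rw [det_updateRow_add, updateRow_comm _ hab, updateRow_comm _ hab, det_updateRow_add,
    det_updateRow_add, updateRow_comm _ hab.symm, updateRow_comm _ hab.symm,
    updateRow_comm _ hab.symm, updateRow_comm _ hab.symm, h0] at h
  rw [← sub_eq_zero, ← h]
  simp only [CharTwo.sub_eq_add, add_zero]
  ring

lemma det_updateRow_single_single_symm {Q : Matrix n n (ZMod 2)} (hQ : Q.IsSymm) {p q r : n}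
    (hpq : p ≠ q) (hpr : p ≠ r) :
    ((Q.updateRow p (Pi.single p 1)).updateRow r (Pi.single q 1)).det =
      ((Q.updateRow p (Pi.single p 1)).updateRow q (Pi.single r 1)).det := by
  set S := (Q.updateRow p (Pi.single p 1)).updateCol p (Pi.single p 1) with hS
  have hsymm : Sᵀ = S := by
    ext i j
    have := congrFun (congrFun hQ i) j
    simp only [transpose_apply] at this
    by_cases hi : i = p <;> by_cases hj : j = p <;>
      simp [hS, updateRow_apply, hi, hj, this]
  have key : ∀ q r, p ≠ r → ((Q.updateRow p (Pi.single p 1)).updateRow r (Pi.single q 1)).det =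
      S.adjugate q r := by
    intro q r hpr
    rw [adjugate_apply]
    refine det_eq_det_of_mulVec_iff fun w => ?_
    have hcol : ∀ i, w p = 0 → (S *ᵥ w) i = (Q.updateRow p (Pi.single p 1) *ᵥ w) i := by
      intro i hp
      refine Finset.sum_congr rfl fun j _ => ?_
      by_cases hj : j = p
      · simp [hj, hp]
      · simp [hS, hj]
    have hrow : ∀ i, i ≠ r → ∀ A : Matrix n n (ZMod 2),
        (A.updateRow r (Pi.single q 1) *ᵥ w) i = (A *ᵥ w) i := by
      intro i hi A
      rw [updateRow_mulVec, Function.update_of_ne hi]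
    have hSp : (S *ᵥ w) p = w p := by
      have : S p = Pi.single p 1 := by
        ext j
        by_cases hj : j = p
        · simp [hS, hj]
        · simp [hS, hj]
      simp [mulVec, this]
    have hQp : (Q.updateRow p (Pi.single p 1) *ᵥ w) p = w p := by
      simp [mulVec]
    have hr : ∀ A : Matrix n n (ZMod 2), (A.updateRow r (Pi.single q 1) *ᵥ w) r = w q := by
      intro A
      simp [mulVec]
    constructor
    · intro h
      have hp : w p = 0 := by rw [← hQp, ← hrow p hpr, h]; rfl
      ext i
      by_cases hi : i = r
      · rw [hi, hr, ← hr (Q.updateRow p (Pi.single p 1)), h]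
      · rw [hrow i hi, hcol i hp, ← hrow i hi, h]
    · intro h
      have hp : w p = 0 := by rw [← hSp, ← hrow p hpr, h]; rfl
      ext i
      by_cases hi : i = r
      · rw [hi, hr, ← hr S, h]
      · rw [hrow i hi, ← hcol i hp, ← hrow i hi, h]
  have hadj := congrFun (congrFun (adjugate_transpose S) r) q
  rw [hsymm] at hadj
  rw [key q r hpr, key r q hpq, ← hadj, transpose_apply]

end ZModTwoDeterminants

section ThreeTerminals

open Matrix

variable {n : Type*} [Fintype n] [DecidableEq n]

/-- For a symmetric matrix with a kernel vector `k`, grounding any coordinate in the support of `k`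
gives the same determinant. -/
lemma det_updateRow_single_eq {Q : Matrix n n (ZMod 2)} (hQ : Q.IsSymm) {k : n → ZMod 2}
    (hk : Q *ᵥ k = 0) {a b : n} (ha : k a = 1) (hb : k b = 1) :
    (Q.updateRow a (Pi.single a 1)).det = (Q.updateRow b (Pi.single b 1)).det := by
  have hker : ∀ a, k a = 1 → ∀ w, Q.updateRow a (Pi.single a 1) *ᵥ w = 0 ↔
      w a = 0 ∧ Q *ᵥ w = 0 := by
    intro a ha w
    rw [updateRow_mulVec, single_one_dotProduct]
    have hsum : ∑ i, k i * (Q *ᵥ w) i = 0 := by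
      have : k ⬝ᵥ (Q *ᵥ w) = 0 := by
        rw [dotProduct_mulVec, ← mulVec_transpose, hQ, hk, zero_dotProduct]
      exact this
    constructor
    · intro h
      refine ⟨by simpa using congrFun h a, ?_⟩
      have hne : ∀ i, i ≠ a → (Q *ᵥ w) i = 0 := fun i hi => by
        simpa [Function.update_of_ne hi] using congrFun h i
      rw [Finset.sum_eq_single a (fun i _ hi => by rw [hne i hi, mul_zero])
        (fun h => absurd (Finset.mem_univ a) h), ha, one_mul] at hsum
      ext i
      by_cases hi : i = a
      · rw [hi, hsum]; rfl
      · exact hne i hi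
    · rintro ⟨h1, h2⟩
      rw [h1, h2]
      simp
  have hmove : ∀ a b, k a = 1 → k b = 1 →
      (∀ w, Q.updateRow a (Pi.single a 1) *ᵥ w = 0 → w = 0) →
      ∀ w, Q.updateRow b (Pi.single b 1) *ᵥ w = 0 → w = 0 := by
    intro a b ha hb h w hw
    rw [hker b hb] at hw
    have h' := h (w + w a • k) ((hker a ha _).2
      ⟨by simp [ha, CharTwo.add_self_eq_zero], by rw [mulVec_add, mulVec_smul, hw.2, hk]; simp⟩)
    have hwa : w a = 0 := by
      have := congrFun h' b
      simpa [hw.1, hb] using this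
    simpa [hwa] using h'
  exact det_eq_det_of_ker_iff ⟨hmove a b ha hb, hmove b a hb ha⟩

/-- Attaching a star with resistances `α₁, α₂, α₃` to three terminals of a symmetric matrix with a
kernel vector: the determinant is governed by five coefficients, related by a quadratic
identity. -/
lemma exists_det_star {Q : Matrix n n (ZMod 2)} (hQ : Q.IsSymm) {k : n → ZMod 2}
    (hk : Q *ᵥ k = 0) {a b c : n} (ha : k a = 1) (hb : k b = 1) (hc : k c = 1)
    (hab : a ≠ b) (hac : a ≠ c) (hbc : b ≠ c) {f₀ f₁ f₂ f₃ : ZMod 2}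
    (h₀ : f₀ = (Q.updateRow c (Pi.single c 1)).det)
    (h₁ : f₁ = ((Q.updateRow a (Pi.single a 1)).updateRow c (Pi.single b 1)).det)
    (h₂ : f₂ = ((Q.updateRow b (Pi.single b 1)).updateRow c (Pi.single a 1)).det)
    (h₃ : f₃ = ((Q.updateRow c (Pi.single c 1)).updateRow b (Pi.single a 1)).det) :
    ∃ t, f₀ * t = f₁ * f₂ + f₁ * f₃ + f₂ * f₃ ∧ ∀ α₁ α₂ α₃ : ZMod 2,
      (((Q.updateRow a (α₁ • Q a + Pi.single a 1)).updateRow b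
        (α₂ • Q b + Pi.single b 1)).updateRow c (α₃ • Q c + Pi.single c 1)).det =
      f₀ * (α₁ * α₂ + α₁ * α₃ + α₂ * α₃) + α₁ * (f₂ + f₃) + α₂ * (f₁ + f₃) + α₃ * (f₁ + f₂) +
        t := by
  have hk0 : k ≠ 0 := fun h => by simp [h] at ha
  have hdet : Q.det = 0 := exists_mulVec_eq_zero_iff.1 ⟨k, hk0, hk⟩
  have hka : (Pi.single a 1 : n → ZMod 2) ⬝ᵥ k = 1 := by rw [single_one_dotProduct, ha]
  have hkb : (Pi.single b 1 : n → ZMod 2) ⬝ᵥ k = 1 := by rw [single_one_dotProduct, hb]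
  have hkc : (Pi.single c 1 : n → ZMod 2) ⬝ᵥ k = 1 := by rw [single_one_dotProduct, hc]
  have hfa : (Q.updateRow a (Pi.single a 1)).det = f₀ := by
    rw [h₀, det_updateRow_single_eq hQ hk ha hc]
  have hfb : (Q.updateRow b (Pi.single b 1)).det = f₀ := by
    rw [h₀, det_updateRow_single_eq hQ hk hb hc]
  have h₁' : ((Q.updateRow a (Pi.single a 1)).updateRow b (Pi.single c 1)).det = f₁ := by
    rw [h₁, det_updateRow_single_single_symm hQ hab hac]
  have h₂' : ((Q.updateRow b (Pi.single b 1)).updateRow a (Pi.single c 1)).det = f₂ := by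
    rw [h₂, det_updateRow_single_single_symm hQ hab.symm hbc]
  have h₃' : ((Q.updateRow c (Pi.single c 1)).updateRow a (Pi.single b 1)).det = f₃ := by
    rw [h₃, det_updateRow_single_single_symm hQ hac.symm hbc.symm]
  have hAC : ((Q.updateRow a (Pi.single a 1)).updateRow c (Pi.single c 1)).det = f₁ + f₃ := by
    rw [det_updateRow_updateRow_cocycle hk0 hk hac (w := Pi.single b 1) (by rw [hka, hkb])
      (by rw [hkc, hkb]), ← h₁, updateRow_comm _ hac (Pi.single b 1), h₃']
  have hBC : ((Q.updateRow b (Pi.single b 1)).updateRow c (Pi.single c 1)).det = f₂ + f₃ := by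
    rw [det_updateRow_updateRow_cocycle hk0 hk hbc (w := Pi.single a 1) (by rw [hka, hkb])
      (by rw [hkc, hka]), ← h₂, updateRow_comm _ hbc (Pi.single a 1), ← h₃]
  have hAB : ((Q.updateRow a (Pi.single a 1)).updateRow b (Pi.single b 1)).det = f₁ + f₂ := by
    rw [det_updateRow_updateRow_cocycle hk0 hk hab (w := Pi.single c 1) (by rw [hka, hkc])
      (by rw [hkb, hkc]), h₁', updateRow_comm _ hab (Pi.single c 1), h₂']
  refine ⟨(((Q.updateRow a (Pi.single a 1)).updateRow b (Pi.single b 1)).updateRow c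
    (Pi.single c 1)).det, ?_, fun α₁ α₂ α₃ => ?_⟩
  · have hJ := det_mul_det_updateRow_updateRow (Q.updateRow c (Pi.single c 1)) hab
      (Pi.single a 1) (Pi.single b 1)
    rw [updateRow_comm Q hac] at hAC
    rw [updateRow_comm Q hbc] at hBC
    rw [updateRow_comm _ hbc, updateRow_comm _ hac, h₀, hJ, hAC, hBC, h₃', ← h₃,
      CharTwo.sub_eq_add]
    linear_combination f₃ * f₃ * (by decide : (2 : ZMod 2) = 0)
  · have e : ∀ (M : Matrix n n (ZMod 2)) (i : n) (α : ZMod 2) (u v : n → ZMod 2),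
        (M.updateRow i (α • u + v)).det = α * (M.updateRow i u).det + (M.updateRow i v).det :=
      fun M i α u v => by rw [det_updateRow_add, det_updateRow_smul]
    have ea : ∀ u v w, ((Q.updateRow a u).updateRow b v).updateRow c w =
        ((Q.updateRow b v).updateRow c w).updateRow a u := fun u v w => by
      rw [updateRow_comm _ hab, updateRow_comm _ hac]
    have eb : ∀ u v w, ((Q.updateRow a u).updateRow b v).updateRow c w =
        ((Q.updateRow a u).updateRow c w).updateRow b v := fun u v w => by
      rw [updateRow_comm _ hbc]
    have sa : ∀ v w, ((Q.updateRow a (Q a)).updateRow b v).updateRow c w =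
        (Q.updateRow b v).updateRow c w := fun v w => by rw [updateRow_eq_self]
    have sb : ∀ u w, ((Q.updateRow a u).updateRow b (Q b)).updateRow c w =
        (Q.updateRow a u).updateRow c w := fun u w => by
      rw [updateRow_comm _ hab, updateRow_eq_self]
    have sc : ∀ u v, ((Q.updateRow a u).updateRow b v).updateRow c (Q c) =
        (Q.updateRow a u).updateRow b v := fun u v => by
      rw [updateRow_comm _ hbc, updateRow_comm _ hac, updateRow_eq_self]
    have tri : ∀ u v w, (((Q.updateRow a (α₁ • Q a + u)).updateRow b (α₂ • Q b + v)).updateRow c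
        (α₃ • Q c + w)).det = α₁ * α₂ * α₃ * Q.det + α₁ * α₂ * (Q.updateRow c w).det +
        α₁ * α₃ * (Q.updateRow b v).det + α₂ * α₃ * (Q.updateRow a u).det +
        α₁ * ((Q.updateRow b v).updateRow c w).det + α₂ * ((Q.updateRow a u).updateRow c w).det +
        α₃ * ((Q.updateRow a u).updateRow b v).det +
        (((Q.updateRow a u).updateRow b v).updateRow c w).det := by
      intro u v w
      have h1 : ∀ u v, (((Q.updateRow a u).updateRow b v).updateRow c (α₃ • Q c + w)).det =
          α₃ * ((Q.updateRow a u).updateRow b v).det +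
          (((Q.updateRow a u).updateRow b v).updateRow c w).det := fun u v => by rw [e, sc]
      have h2 : ∀ u w, (((Q.updateRow a u).updateRow b (α₂ • Q b + v)).updateRow c w).det =
          α₂ * ((Q.updateRow a u).updateRow c w).det +
          (((Q.updateRow a u).updateRow b v).updateRow c w).det := fun u w => by
        rw [eb, e, ← eb, sb, ← eb]
      have h3 : ∀ v w, (((Q.updateRow a (α₁ • Q a + u)).updateRow b v).updateRow c w).det =
          α₁ * ((Q.updateRow b v).updateRow c w).det +
          (((Q.updateRow a u).updateRow b v).updateRow c w).det := fun v w => by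
        rw [ea, e, ← ea, sa, ← ea]
      have h2' : ∀ u, ((Q.updateRow a u).updateRow b (α₂ • Q b + v)).det =
          α₂ * (Q.updateRow a u).det + ((Q.updateRow a u).updateRow b v).det := fun u => by
        have := h2 u (Q c)
        rwa [sc, sc, updateRow_comm _ hac, updateRow_eq_self] at this
      have h3' : ∀ v, ((Q.updateRow a (α₁ • Q a + u)).updateRow b v).det =
          α₁ * (Q.updateRow b v).det + ((Q.updateRow a u).updateRow b v).det := fun v => by
        rw [updateRow_comm _ hab, e, updateRow_comm _ hab.symm, updateRow_eq_self,
          updateRow_comm _ hab.symm]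
      have h3'' : ∀ w, ((Q.updateRow a (α₁ • Q a + u)).updateRow c w).det =
          α₁ * (Q.updateRow c w).det + ((Q.updateRow a u).updateRow c w).det := fun w => by
        rw [updateRow_comm _ hac, e, updateRow_comm _ hac.symm, updateRow_eq_self,
          updateRow_comm _ hac.symm]
      rw [h1, h2', h2, h3', h3'', h3, e, updateRow_eq_self]
      ring
    rw [tri, hdet, ← h₀, hfa, hfb, hAC, hBC, hAB]
    ring

end ThreeTerminals

section Networks

open Matrix

variable {E V : Type*} [Fintype E] [DecidableEq E] [Fintype V] [DecidableEq V]

/-- The expanded Laplacian over `ZMod 2` of a network with incidence matrix `B` and resistances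
`x`. -/
def expandedLaplacian (B : Matrix E V (ZMod 2)) (x : E → ZMod 2) :
    Matrix (E ⊕ V) (E ⊕ V) (ZMod 2) :=
  fromBlocks (diagonal x) B Bᵀ 0

lemma expandedLaplacian_isSymm (B : Matrix E V (ZMod 2)) (x : E → ZMod 2) :
    (expandedLaplacian B x).IsSymm := by
  simp [expandedLaplacian, IsSymm, fromBlocks_transpose]

lemma expandedLaplacian_mulVec_inl (B : Matrix E V (ZMod 2)) (x : E → ZMod 2)
    (w : E ⊕ V → ZMod 2) (e : E) :
    (expandedLaplacian B x *ᵥ w) (Sum.inl e) =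
      x e * w (Sum.inl e) + (B *ᵥ (w ∘ Sum.inr)) e := by
  simp [expandedLaplacian, fromBlocks_mulVec, mulVec_diagonal]

lemma expandedLaplacian_mulVec_inr (B : Matrix E V (ZMod 2)) (x : E → ZMod 2)
    (w : E ⊕ V → ZMod 2) (v : V) :
    (expandedLaplacian B x *ᵥ w) (Sum.inr v) = (Bᵀ *ᵥ (w ∘ Sum.inl)) v := by
  simp [expandedLaplacian, fromBlocks_mulVec]

/-- The tree polynomial of a network, with root `c`. -/
def treeDet (B : Matrix E V (ZMod 2)) (x : E → ZMod 2) (c : V) : ZMod 2 :=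
  ((expandedLaplacian B x).updateRow (Sum.inr c) (Pi.single (Sum.inr c) 1)).det

/-- The polynomial of 2-forests of a network separating `p` from both `q` and `r`. -/
def forestDet (B : Matrix E V (ZMod 2)) (x : E → ZMod 2) (p q r : V) : ZMod 2 :=
  (((expandedLaplacian B x).updateRow (Sum.inr p) (Pi.single (Sum.inr p) 1)).updateRow
    (Sum.inr r) (Pi.single (Sum.inr q) 1)).det

lemma forestDet_comm (B : Matrix E V (ZMod 2)) (x : E → ZMod 2) {p q r : V} (hpq : p ≠ q)
    (hpr : p ≠ r) : forestDet B x p q r = forestDet B x p r q :=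
  det_updateRow_single_single_symm (expandedLaplacian_isSymm B x)
    (Sum.inr_injective.ne hpq) (Sum.inr_injective.ne hpr)

/-- `F` is a spanning tree, expressed by the absence of potentials that are constant along `F`
and of cycles in `F`. -/
def IsTreeSet (B : Matrix E V (ZMod 2)) (c : V) (F : Finset E) : Prop :=
  (∀ z : V → ZMod 2, z c = 0 → (∀ e ∈ F, (B *ᵥ z) e = 0) → z = 0) ∧
    ∀ y : E → ZMod 2, (∀ e ∉ F, y e = 0) → (∀ v ≠ c, (Bᵀ *ᵥ y) v = 0) → y = 0

/-- `F` is a spanning forest with two components, one containing `p` and the other one containing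
`q` and `r`. -/
def IsForestSet (B : Matrix E V (ZMod 2)) (p q r : V) (F : Finset E) : Prop :=
  (∀ z : V → ZMod 2, z p = 0 → z q = 0 → (∀ e ∈ F, (B *ᵥ z) e = 0) → z = 0) ∧
    ∀ y : E → ZMod 2, (∀ e ∉ F, y e = 0) → (∀ v, v ≠ p → v ≠ r → (Bᵀ *ᵥ y) v = 0) → y = 0

lemma treeDet_ker_iff (B : Matrix E V (ZMod 2)) (x : E → ZMod 2) (c : V) (w : E ⊕ V → ZMod 2) :
    (expandedLaplacian B x).updateRow (Sum.inr c) (Pi.single (Sum.inr c) 1) *ᵥ w = 0 ↔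
      (∀ e, x e * w (Sum.inl e) + (B *ᵥ (w ∘ Sum.inr)) e = 0) ∧
      (∀ v ≠ c, (Bᵀ *ᵥ (w ∘ Sum.inl)) v = 0) ∧ w (Sum.inr c) = 0 := by
  rw [updateRow_mulVec, single_one_dotProduct]
  constructor
  · intro h
    refine ⟨fun e => ?_, fun v hv => ?_, ?_⟩
    · simpa [expandedLaplacian_mulVec_inl] using congrFun h (Sum.inl e)
    · simpa [expandedLaplacian_mulVec_inr, hv] using congrFun h (Sum.inr v)
    · simpa using congrFun h (Sum.inr c)
  · rintro ⟨h1, h2, h3⟩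
    ext (e | v)
    · simpa [expandedLaplacian_mulVec_inl] using h1 e
    · by_cases hv : v = c
      · simpa [hv] using h3
      · simpa [expandedLaplacian_mulVec_inr, hv] using h2 v hv

lemma forestDet_ker_iff (B : Matrix E V (ZMod 2)) (x : E → ZMod 2) {p r : V} (q : V) (hpr : p ≠ r)
    (w : E ⊕ V → ZMod 2) :
    ((expandedLaplacian B x).updateRow (Sum.inr p) (Pi.single (Sum.inr p) 1)).updateRow
        (Sum.inr r) (Pi.single (Sum.inr q) 1) *ᵥ w = 0 ↔
      (∀ e, x e * w (Sum.inl e) + (B *ᵥ (w ∘ Sum.inr)) e = 0) ∧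
      (∀ v, v ≠ p → v ≠ r → (Bᵀ *ᵥ (w ∘ Sum.inl)) v = 0) ∧
      w (Sum.inr p) = 0 ∧ w (Sum.inr q) = 0 := by
  rw [updateRow_mulVec, updateRow_mulVec, single_one_dotProduct, single_one_dotProduct]
  constructor
  · intro h
    refine ⟨fun e => ?_, fun v hp hr => ?_, ?_, ?_⟩
    · simpa [expandedLaplacian_mulVec_inl] using congrFun h (Sum.inl e)
    · simpa [expandedLaplacian_mulVec_inr, hp, hr] using congrFun h (Sum.inr v)
    · simpa [hpr] using congrFun h (Sum.inr p)
    · simpa using congrFun h (Sum.inr r)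
  · rintro ⟨h1, h2, h3, h4⟩
    ext (e | v)
    · simpa [expandedLaplacian_mulVec_inl] using h1 e
    · by_cases hr : v = r
      · simpa [hr] using h4
      · by_cases hp : v = p
        · simpa [hp, hpr] using h3
        · simpa [expandedLaplacian_mulVec_inr, hp, hr] using h2 v hp hr

/-- The incidence matrix of the subnetwork with edge set `F`. -/
def restrictEdges (B : Matrix E V (ZMod 2)) (F : Finset E) : Matrix E V (ZMod 2) :=
  of fun e v => if e ∈ F then B e v else 0

lemma restrictEdges_mulVec (B : Matrix E V (ZMod 2)) (F : Finset E) (z : V → ZMod 2) (e : E) :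
    (restrictEdges B F *ᵥ z) e = if e ∈ F then (B *ᵥ z) e else 0 := by
  by_cases h : e ∈ F <;> simp [restrictEdges, mulVec, dotProduct, h]

lemma restrictEdges_transpose_mulVec (B : Matrix E V (ZMod 2)) {F : Finset E} {y : E → ZMod 2}
    (hy : ∀ e ∉ F, y e = 0) (v : V) : ((restrictEdges B F)ᵀ *ᵥ y) v = (Bᵀ *ᵥ y) v := by
  refine Finset.sum_congr rfl fun e _ => ?_
  by_cases h : e ∈ F <;> simp [restrictEdges, h, hy]

/-- The indicator of the complement of an edge set. -/
def complIndicator (F : Finset E) (e : E) : ZMod 2 := if e ∈ F then 0 else 1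

lemma restricted_edge_rows_iff (B : Matrix E V (ZMod 2)) (F : Finset E) (w : E ⊕ V → ZMod 2) :
    (∀ e, complIndicator F e * w (Sum.inl e) + (restrictEdges B F *ᵥ (w ∘ Sum.inr)) e = 0) ↔
      (∀ e ∉ F, (w ∘ Sum.inl) e = 0) ∧ ∀ e ∈ F, (B *ᵥ (w ∘ Sum.inr)) e = 0 := by
  rw [← forall_and]
  refine forall_congr' fun e => ?_
  by_cases h : e ∈ F <;> simp [complIndicator, restrictEdges_mulVec, h]

lemma forall_sum_split {P : (E → ZMod 2) → Prop} {Q : (V → ZMod 2) → Prop} (hP : P 0)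
    (hQ : Q 0) :
    (∀ w : E ⊕ V → ZMod 2, P (w ∘ Sum.inl) → Q (w ∘ Sum.inr) → w = 0) ↔
      (∀ z, Q z → z = 0) ∧ ∀ y, P y → y = 0 := by
  constructor
  · intro h
    refine ⟨fun z hz => ?_, fun y hy => ?_⟩
    · have := h (Sum.elim 0 z) hP hz
      exact funext fun v => congrFun this (Sum.inr v)
    · have := h (Sum.elim y 0) hy hQ
      exact funext fun e => congrFun this (Sum.inl e)
  · rintro ⟨h1, h2⟩ w hy hz
    ext (e | v)
    · exact congrFun (h2 _ hy) e
    · exact congrFun (h1 _ hz) v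

lemma treeDet_restrictEdges (B : Matrix E V (ZMod 2)) (c : V) (F : Finset E) :
    treeDet (restrictEdges B F) (complIndicator F) c = 1 ↔ IsTreeSet B c F := by
  have h : IsTreeSet B c F ↔ _ := and_congr (forall_congr' fun z => and_imp.symm)
    (forall_congr' fun y => and_imp.symm)
  rw [treeDet, det_eq_one_iff, h, ← forall_sum_split (by simp) (by simp)]
  refine forall_congr' fun w => ?_
  rw [treeDet_ker_iff, restricted_edge_rows_iff, ← and_imp]
  refine imp_congr_left ⟨fun ⟨⟨a, b⟩, c, d⟩ => ⟨⟨a, fun v hv => ?_⟩, d, b⟩,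
    fun ⟨⟨a, c⟩, d, b⟩ => ⟨⟨a, b⟩, fun v hv => ?_, d⟩⟩
  · rw [← restrictEdges_transpose_mulVec B a, c v hv]
  · rw [restrictEdges_transpose_mulVec B a, c v hv]

lemma forestDet_restrictEdges (B : Matrix E V (ZMod 2)) {p r : V} (q : V) (hpr : p ≠ r)
    (F : Finset E) :
    forestDet (restrictEdges B F) (complIndicator F) p q r = 1 ↔ IsForestSet B p q r F := by
  have h : IsForestSet B p q r F ↔ _ := and_congr
    (forall_congr' fun z => (imp_congr_right fun _ => and_imp.symm).trans and_imp.symm)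
    (forall_congr' fun y => and_imp.symm)
  rw [forestDet, det_eq_one_iff, h, ← forall_sum_split (by simp) (by simp)]
  refine forall_congr' fun w => ?_
  rw [forestDet_ker_iff _ _ _ hpr, restricted_edge_rows_iff, ← and_imp]
  refine imp_congr_left ⟨fun ⟨⟨a, b⟩, c, d, e⟩ => ⟨⟨a, fun v hp hr => ?_⟩, d, e, b⟩,
    fun ⟨⟨a, c⟩, d, e, b⟩ => ⟨⟨a, b⟩, fun v hp hr => ?_, d, e⟩⟩
  · rw [← restrictEdges_transpose_mulVec B a, c v hp hr]
  · rw [restrictEdges_transpose_mulVec B a, c v hp hr]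

lemma isForestSet_comm (B : Matrix E V (ZMod 2)) {p q r : V} (hpq : p ≠ q) (hpr : p ≠ r)
    (F : Finset E) : IsForestSet B p q r F ↔ IsForestSet B p r q F := by
  rw [← forestDet_restrictEdges B q hpr, ← forestDet_restrictEdges B r hpq,
    forestDet_comm _ _ hpq hpr]

/-- Expansion of the determinant of a network matrix in the resistances. -/
lemma det_eq_sum_prod_compl (B : Matrix E V (ZMod 2)) (x : E → ZMod 2)
    (C : V → E ⊕ V → ZMod 2) :
    (of (Sum.elim (fun e => Sum.elim (Pi.single e (x e)) (B e)) C)).det =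
      ∑ F : Finset E, (∏ e ∈ Fᶜ, x e) * (of (Sum.elim (fun e =>
        Sum.elim (Pi.single e (complIndicator F e)) (restrictEdges B F e)) C)).det := by
  let g := (detRowAlternating (R := ZMod 2) (n := E ⊕ V)).toMultilinearMap.currySum
  have hg : ∀ u, (of (Sum.elim u C)).det = g u C := fun u => by
    simp only [g, MultilinearMap.currySum_apply]
    rfl
  let m : E → E ⊕ V → ZMod 2 := fun e => Sum.elim 0 (B e)
  let m' : E → E ⊕ V → ZMod 2 := fun e => Sum.elim (Pi.single e 1) 0
  have hx : (fun e => Sum.elim (Pi.single e (x e)) (B e)) = m + fun e => x e • m' e := by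
    ext e (e' | v)
    · by_cases h : e' = e
      · subst h
        simp [m, m']
      · simp [m, m', h]
    · simp [m, m']
  rw [hg, hx, g.map_add_univ, _root_.sum_apply]
  refine Finset.sum_congr rfl fun F _ => ?_
  have hF : (fun e => Sum.elim (Pi.single e (complIndicator F e)) (restrictEdges B F e)) =
      F.piecewise m m' := by
    ext e i
    by_cases h : e ∈ F <;> rcases i with e' | v <;>
      simp [m, m', h, complIndicator, restrictEdges, Pi.single_apply]
  have hF' : F.piecewise m (fun e => x e • m' e) =
      Fᶜ.piecewise (fun e => x e • F.piecewise m m' e) (F.piecewise m m') := by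
    ext e i
    by_cases h : e ∈ F <;> simp [h]
  rw [hF', g.map_piecewise_smul, hg, hF]
  rfl

lemma eq_ite_of_eq_one_iff {a : ZMod 2} {P : Prop} [Decidable P] (h : a = 1 ↔ P) :
    a = if P then 1 else 0 := by
  split_ifs with hP
  · exact h.2 hP
  · exact (by decide : ∀ a : ZMod 2, a ≠ 1 → a = 0) a (mt h.1 hP)

lemma det_sumElim_congr (B : Matrix E V (ZMod 2)) (F : Finset E) {C C' : V → E ⊕ V → ZMod 2}
    (hC : ∀ w, (∀ e ∉ F, (w ∘ Sum.inl) e = 0) → ∀ v, C v ⬝ᵥ w = C' v ⬝ᵥ w) :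
    (of (Sum.elim (fun e =>
        Sum.elim (Pi.single e (complIndicator F e)) (restrictEdges B F e)) C)).det =
      (of (Sum.elim (fun e =>
        Sum.elim (Pi.single e (complIndicator F e)) (restrictEdges B F e)) C')).det := by
  refine det_eq_det_of_mulVec_iff fun w => ?_
  have key : ∀ C : V → E ⊕ V → ZMod 2, of (Sum.elim (fun e =>
        Sum.elim (Pi.single e (complIndicator F e)) (restrictEdges B F e)) C) *ᵥ w = 0 ↔
      ((∀ e ∉ F, (w ∘ Sum.inl) e = 0) ∧ ∀ e ∈ F, (B *ᵥ (w ∘ Sum.inr)) e = 0) ∧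
        ∀ v, C v ⬝ᵥ w = 0 := fun C => by
    rw [← restricted_edge_rows_iff, funext_iff, Sum.forall]
    refine and_congr (forall_congr' fun e => ?_) Iff.rfl
    simp [mulVec, dotProduct, Pi.single_apply]
  rw [key, key]
  refine and_congr_right fun h => forall_congr' fun v => ?_
  rw [hC w h.1 v]

lemma expandedLaplacian_inr_dotProduct (B : Matrix E V (ZMod 2)) (x : E → ZMod 2)
    (w : E ⊕ V → ZMod 2) (v : V) :
    expandedLaplacian B x (Sum.inr v) ⬝ᵥ w = (Bᵀ *ᵥ (w ∘ Sum.inl)) v :=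
  expandedLaplacian_mulVec_inr B x w v

lemma treeDet_eq_sum (B : Matrix E V (ZMod 2)) (x : E → ZMod 2) (c : V) :
    treeDet B x c = ∑ F : Finset E, if IsTreeSet B c F then ∏ e ∈ Fᶜ, x e else 0 := by
  have hM : ∀ (B : Matrix E V (ZMod 2)) (x : E → ZMod 2),
      (expandedLaplacian B x).updateRow (Sum.inr c) (Pi.single (Sum.inr c) 1) =
      of (Sum.elim (fun e => Sum.elim (Pi.single e (x e)) (B e))
        fun v => ((expandedLaplacian B x).updateRow (Sum.inr c) (Pi.single (Sum.inr c) 1))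
          (Sum.inr v)) := fun B x => by
    ext (e | v) (e' | v') <;>
      simp [expandedLaplacian, diagonal_apply, Pi.single_apply, eq_comm]
  rw [treeDet, hM, det_eq_sum_prod_compl]
  refine Finset.sum_congr rfl fun F _ => ?_
  rw [← mul_boole]
  congr 1
  rw [← eq_ite_of_eq_one_iff (treeDet_restrictEdges B c F), treeDet,
    hM (restrictEdges B F)]
  refine det_sumElim_congr B F fun w hw v => ?_
  by_cases h : v = c
  · simp [h]
  · simp only [ne_eq, Sum.inr.injEq, h, not_false_eq_true, updateRow_ne,
      expandedLaplacian_inr_dotProduct]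
    exact (restrictEdges_transpose_mulVec B hw v).symm

lemma forestDet_eq_sum (B : Matrix E V (ZMod 2)) (x : E → ZMod 2) {p r : V} (q : V)
    (hpr : p ≠ r) : forestDet B x p q r =
      ∑ F : Finset E, if IsForestSet B p q r F then ∏ e ∈ Fᶜ, x e else 0 := by
  have hM : ∀ (B : Matrix E V (ZMod 2)) (x : E → ZMod 2),
      ((expandedLaplacian B x).updateRow (Sum.inr p) (Pi.single (Sum.inr p) 1)).updateRow
        (Sum.inr r) (Pi.single (Sum.inr q) 1) =
      of (Sum.elim (fun e => Sum.elim (Pi.single e (x e)) (B e))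
        fun v => (((expandedLaplacian B x).updateRow (Sum.inr p)
          (Pi.single (Sum.inr p) 1)).updateRow (Sum.inr r) (Pi.single (Sum.inr q) 1))
          (Sum.inr v)) := fun B x => by
    ext (e | v) (e' | v') <;>
      simp [expandedLaplacian, diagonal_apply, Pi.single_apply, eq_comm]
  rw [forestDet, hM, det_eq_sum_prod_compl]
  refine Finset.sum_congr rfl fun F _ => ?_
  rw [← mul_boole]
  congr 1
  rw [← eq_ite_of_eq_one_iff (forestDet_restrictEdges B q hpr F), forestDet,
    hM (restrictEdges B F)]
  refine det_sumElim_congr B F fun w hw v => ?_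
  by_cases hr : v = r
  · simp [hr]
  by_cases h : v = p
  · simp [h, hpr]
  · simp only [ne_eq, Sum.inr.injEq, h, hr, not_false_eq_true, updateRow_ne,
      expandedLaplacian_inr_dotProduct]
    exact (restrictEdges_transpose_mulVec B hw v).symm

end Networks

section NetworkEquiv

open Matrix

variable {E V E' V' : Type*} [Fintype E] [DecidableEq E] [Fintype V] [DecidableEq V]
  [Fintype E'] [DecidableEq E'] [Fintype V'] [DecidableEq V']

lemma expandedLaplacian_submatrix (B : Matrix E V (ZMod 2)) (x : E → ZMod 2) (φ : E' ≃ E)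
    (ψ : V' ≃ V) : expandedLaplacian (B.submatrix φ ψ) (x ∘ φ) =
      (expandedLaplacian B x).submatrix (φ.sumCongr ψ) (φ.sumCongr ψ) := by
  ext (e | v) (e' | v') <;> simp [expandedLaplacian, diagonal_apply]

lemma single_comp_sumCongr_inr (φ : E' ≃ E) (ψ : V' ≃ V) (v : V') :
    (Pi.single (Sum.inr (ψ v)) 1 : E ⊕ V → ZMod 2) ∘ φ.sumCongr ψ = Pi.single (Sum.inr v) 1 := by
  ext (e | w) <;> simp [Pi.single_apply]

lemma treeDet_submatrix (B : Matrix E V (ZMod 2)) (x : E → ZMod 2) (φ : E' ≃ E)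
    (ψ : V' ≃ V) (c : V') :
    treeDet (B.submatrix φ ψ) (x ∘ φ) c = treeDet B x (ψ c) := by
  rw [treeDet, treeDet, ← det_submatrix_equiv_self (φ.sumCongr ψ), submatrix_updateRow_equiv,
    expandedLaplacian_submatrix]
  simp [← single_comp_sumCongr_inr φ ψ, Function.comp_def]

lemma forestDet_submatrix (B : Matrix E V (ZMod 2)) (x : E → ZMod 2) (φ : E' ≃ E)
    (ψ : V' ≃ V) (p q r : V') :
    forestDet (B.submatrix φ ψ) (x ∘ φ) p q r = forestDet B x (ψ p) (ψ q) (ψ r) := by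
  rw [forestDet, forestDet, ← det_submatrix_equiv_self (φ.sumCongr ψ), submatrix_updateRow_equiv,
    submatrix_updateRow_equiv, expandedLaplacian_submatrix]
  simp [← single_comp_sumCongr_inr φ ψ, Function.comp_def]

lemma restrictEdges_submatrix (B : Matrix E V (ZMod 2)) (φ : E' ≃ E) (ψ : V' ≃ V)
    (F : Finset E') : restrictEdges (B.submatrix φ ψ) F =
      (restrictEdges B (F.map φ.toEmbedding)).submatrix φ ψ := by
  ext e v
  simp [restrictEdges]

lemma complIndicator_map_comp (φ : E' ≃ E) (F : Finset E') :
    complIndicator (F.map φ.toEmbedding) ∘ φ = complIndicator F := by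
  ext e
  simp [complIndicator]

lemma isTreeSet_submatrix (B : Matrix E V (ZMod 2)) (φ : E' ≃ E) (ψ : V' ≃ V) (c : V')
    (F : Finset E') :
    IsTreeSet (B.submatrix φ ψ) c F ↔ IsTreeSet B (ψ c) (F.map φ.toEmbedding) := by
  rw [← treeDet_restrictEdges, ← treeDet_restrictEdges, restrictEdges_submatrix,
    ← treeDet_submatrix _ _ φ ψ, complIndicator_map_comp]

lemma isForestSet_submatrix (B : Matrix E V (ZMod 2)) (φ : E' ≃ E) (ψ : V' ≃ V) {p r : V'}
    (q : V') (hpr : p ≠ r) (F : Finset E') :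
    IsForestSet (B.submatrix φ ψ) p q r F ↔
      IsForestSet B (ψ p) (ψ q) (ψ r) (F.map φ.toEmbedding) := by
  rw [← forestDet_restrictEdges _ _ hpr, ← forestDet_restrictEdges _ _ (ψ.injective.ne hpr),
    restrictEdges_submatrix, ← forestDet_submatrix _ _ φ ψ, complIndicator_map_comp]

end NetworkEquiv

section Incidence

open Matrix

variable {E V : Type*} [Fintype E] [DecidableEq E] [Fintype V] [DecidableEq V]

/-- The incidence matrix over `ZMod 2` of the multigraph in which the edge `e` joins `s e` and
`t e`. -/
def incidence (s t : E → V) : Matrix E V (ZMod 2) :=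
  of fun e => Pi.single (s e) 1 + Pi.single (t e) 1

lemma incidence_mulVec (s t : E → V) (z : V → ZMod 2) (e : E) :
    (incidence s t *ᵥ z) e = z (s e) + z (t e) := by
  change (Pi.single (s e) 1 + Pi.single (t e) 1) ⬝ᵥ z = _
  simp [add_dotProduct]

lemma sum_divergence_mul (s t : E → V) (y : E → ZMod 2) (z : V → ZMod 2) :
    ∑ v, ((incidence s t)ᵀ *ᵥ y) v * z v = ∑ e, y e * (z (s e) + z (t e)) := by
  simp_rw [← incidence_mulVec]
  change ((incidence s t)ᵀ *ᵥ y) ⬝ᵥ z = y ⬝ᵥ (incidence s t *ᵥ z)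
  rw [mulVec_transpose, dotProduct_mulVec]

lemma sum_divergence (s t : E → V) (y : E → ZMod 2) :
    ∑ v, ((incidence s t)ᵀ *ᵥ y) v = 0 := by
  simpa [CharTwo.add_self_eq_zero] using sum_divergence_mul s t y 1

lemma divergence_single (s t : E → V) (e : E) :
    (incidence s t)ᵀ *ᵥ Pi.single e 1 = Pi.single (s e) 1 + Pi.single (t e) 1 := by
  ext v
  simp [incidence]

lemma IsTreeSet.divergence_eq_zero {s t : E → V} {c : V} {F : Finset E}
    (h : IsTreeSet (incidence s t) c F) {y : E → ZMod 2} (hy : ∀ e ∉ F, y e = 0)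
    (hdiv : (incidence s t)ᵀ *ᵥ y = 0) : y = 0 :=
  h.2 y hy fun v _ => congrFun hdiv v

end Incidence

section SpanningTrees

open Matrix

variable {E V : Type*} [Fintype E] [DecidableEq E] [Fintype V] [DecidableEq V]
  {s t : E → V} {F : Finset E}

/-- The graph whose edges are the `s e`–`t e` for `e ∈ F`. -/
def edgeGraph (s t : E → V) (F : Finset E) : SimpleGraph V :=
  SimpleGraph.fromEdgeSet ((fun e => s(s e, t e)) '' (F : Set E))

lemma pi_zmod_two_add_self {ι : Type*} (z : ι → ZMod 2) : z + z = 0 :=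
  funext fun i => CharTwo.add_self_eq_zero (z i)

lemma edgeGraph_adj {a b : V} :
    (edgeGraph s t F).Adj a b ↔ (∃ e ∈ F, s(s e, t e) = s(a, b)) ∧ a ≠ b := by
  simp [edgeGraph]

lemma eq_of_reachable_edgeGraph {z : V → ZMod 2} (hz : ∀ e ∈ F, z (s e) + z (t e) = 0) {a b : V}
    (h : (edgeGraph s t F).Reachable a b) : z a = z b := by
  obtain ⟨w⟩ := h
  induction w with
  | nil => rfl
  | cons hadj _ ih =>
    obtain ⟨⟨e, he, hab⟩, -⟩ := edgeGraph_adj.1 hadj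
    have := CharTwo.add_eq_zero.1 (hz e he)
    rcases Sym2.eq_iff.1 hab with ⟨rfl, rfl⟩ | ⟨rfl, rfl⟩
    · rw [this, ih]
    · rw [← this, ih]

lemma exists_flow_of_reachable {a b : V} (h : (edgeGraph s t F).Reachable a b) :
    ∃ y : E → ZMod 2, (∀ e ∉ F, y e = 0) ∧
      (incidence s t)ᵀ *ᵥ y = Pi.single a 1 + Pi.single b 1 := by
  obtain ⟨w⟩ := h
  induction w with
  | nil => exact ⟨0, by simp [pi_zmod_two_add_self]⟩
  | @cons a b c hadj _ ih =>
    obtain ⟨y, hy, hdiv⟩ := ih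
    obtain ⟨⟨e, he, hab⟩, -⟩ := edgeGraph_adj.1 hadj
    refine ⟨y + Pi.single e 1, fun e' he' => ?_, ?_⟩
    · simp [hy e' he', ne_of_mem_of_not_mem he he']
    · have : (Pi.single (s e) 1 + Pi.single (t e) 1 : V → ZMod 2) =
          Pi.single a 1 + Pi.single b 1 := by
        rcases Sym2.eq_iff.1 hab with ⟨rfl, rfl⟩ | ⟨rfl, rfl⟩
        · rfl
        · rw [add_comm]
      rw [mulVec_add, divergence_single, hdiv, this, add_comm, add_assoc,
        ← add_assoc (Pi.single b 1), pi_zmod_two_add_self, zero_add]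

lemma reachable_edgeGraph_of_potential {c : V}
    (h : ∀ z : V → ZMod 2, z c = 0 → (∀ e ∈ F, (incidence s t *ᵥ z) e = 0) → z = 0) (v : V) :
    (edgeGraph s t F).Reachable c v := by
  classical
  have := h (fun v => if (edgeGraph s t F).Reachable c v then 0 else 1) (by simp) fun e he => ?_
  · by_contra hv
    simpa [hv] using congrFun this v
  · rw [incidence_mulVec]
    have : (edgeGraph s t F).Reachable c (s e) ↔ (edgeGraph s t F).Reachable c (t e) := by
      by_cases hst : s e = t e
      · rw [hst]
      · have hadj : (edgeGraph s t F).Reachable (s e) (t e) :=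
          (edgeGraph_adj.2 ⟨⟨e, he, rfl⟩, hst⟩).reachable
        exact ⟨fun h => h.trans hadj, fun h => h.trans hadj.symm⟩
    simp only [this]
    exact CharTwo.add_self_eq_zero _

lemma IsTreeSet.reachable {c : V} (h : IsTreeSet (incidence s t) c F) (a b : V) :
    (edgeGraph s t F).Reachable a b :=
  (reachable_edgeGraph_of_potential h.1 a).symm.trans (reachable_edgeGraph_of_potential h.1 b)

lemma isBridge_edgeGraph_iff (hinj : Function.Injective fun e => s(s e, t e)) (e : E) :
    (edgeGraph s t F).IsBridge s(s e, t e) ↔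
      ¬ (edgeGraph s t (F.erase e)).Reachable (s e) (t e) := by
  rw [SimpleGraph.isBridge_iff]
  have : (edgeGraph s t F).deleteEdges {s(s e, t e)} = edgeGraph s t (F.erase e) := by
    rw [edgeGraph, edgeGraph, SimpleGraph.deleteEdges_fromEdgeSet, Finset.coe_erase,
      Set.image_sdiff hinj, Set.image_singleton]
  rw [this]

lemma isTreeSet_iff (hinj : Function.Injective fun e => s(s e, t e)) (hst : ∀ e, s e ≠ t e)
    (c : V) : IsTreeSet (incidence s t) c F ↔
      (edgeGraph s t F).Connected ∧ (edgeGraph s t F).IsAcyclic := by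
  rw [SimpleGraph.isAcyclic_iff_forall_isBridge]
  constructor
  · intro h
    have : Nonempty V := ⟨c⟩
    refine ⟨⟨h.reachable⟩, ?_⟩
    intro ε hε
    obtain ⟨⟨e, he, rfl⟩, -⟩ : ε ∈ _ '' _ ∧ _ := by
      simpa only [edgeGraph, SimpleGraph.edgeSet_fromEdgeSet, Set.mem_sdiff] using hε
    rw [isBridge_edgeGraph_iff hinj]
    intro hr
    obtain ⟨y, hy, hdiv⟩ := exists_flow_of_reachable hr
    have := h.divergence_eq_zero (y := y + Pi.single e 1) (fun e' he' => ?_) (by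
      rw [mulVec_add, divergence_single, hdiv, pi_zmod_two_add_self])
    · simpa [hy e (by simp)] using congrFun this e
    · have : e' ≠ e := (ne_of_mem_of_not_mem he he').symm
      simp [hy e' (by simp [he']), this]
  · rintro ⟨hc, hb⟩
    refine ⟨fun z hz h => ?_, fun y hy h => ?_⟩
    · simp_rw [incidence_mulVec] at h
      ext v
      rw [eq_of_reachable_edgeGraph h (hc.preconnected v c), hz, Pi.zero_apply]
    · have hdiv : (incidence s t)ᵀ *ᵥ y = 0 := by
        have hsum := sum_divergence s t y
        rw [Finset.sum_eq_single_of_mem c (Finset.mem_univ c) fun v _ hv => h v hv] at hsum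
        ext v
        by_cases hv : v = c
        · rw [hv, hsum, Pi.zero_apply]
        · exact h v hv
      ext e
      by_cases he : e ∈ F
      swap
      · exact hy e he
      have hbr := hb (e := s(s e, t e)) (by
        rw [edgeGraph, SimpleGraph.edgeSet_fromEdgeSet]
        exact ⟨⟨e, he, rfl⟩, by simpa using hst e⟩)
      rw [isBridge_edgeGraph_iff hinj] at hbr
      let z : V → ZMod 2 := fun v => if (edgeGraph s t (F.erase e)).Reachable (s e) v then 1 else 0
      have key := sum_divergence_mul s t y z
      rw [hdiv, Finset.sum_eq_single_of_mem e (Finset.mem_univ e)] at key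
      · simpa [z, hbr] using key.symm
      · intro e' _ hne
        by_cases he' : e' ∈ F
        swap
        · rw [hy e' he', zero_mul]
        have hadj : (edgeGraph s t (F.erase e)).Reachable (s e') (t e') :=
          (edgeGraph_adj.2 ⟨⟨e', by simp [hne, he'], rfl⟩, hst e'⟩).reachable
        have : (edgeGraph s t (F.erase e)).Reachable (s e) (s e') ↔
            (edgeGraph s t (F.erase e)).Reachable (s e) (t e') :=
          ⟨fun h => h.trans hadj, fun h => h.trans hadj.symm⟩
        simp only [z, this]
        rw [CharTwo.add_self_eq_zero, mul_zero]

end SpanningTrees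

section KirchhoffPolynomial

open Matrix

variable {E V : Type} [Fintype E] [DecidableEq E] [Fintype V] [DecidableEq V] {s t : E → V}

lemma isSpanningTree_map_iff {G : SimpleGraph V} (ε : E ≃ G.edgeSet)
    (hε : ∀ e, (ε e : Sym2 V) = s(s e, t e)) (c : V) (F : Finset E) :
    IsSpanningTree G (F.map (ε.toEmbedding.trans (Function.Embedding.subtype _)) : Set (Sym2 V)) ↔
      IsTreeSet (incidence s t) c F := by
  have hinj : Function.Injective fun e => s(s e, t e) := by
    simp only [← hε]
    exact Subtype.val_injective.comp ε.injective
  have hst : ∀ e, s e ≠ t e := fun e => by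
    have := (ε e).2
    rw [hε] at this
    exact G.ne_of_adj this
  have him : (F.map (ε.toEmbedding.trans (Function.Embedding.subtype _)) : Set (Sym2 V)) =
      (fun e => s(s e, t e)) '' (F : Set E) := by
    simp only [← hε, Finset.coe_map]
    rfl
  rw [isTreeSet_iff hinj hst, IsSpanningTree, him, edgeGraph, and_iff_right]
  rintro _ ⟨e, -, rfl⟩
  simp only [← hε]
  exact (ε e).2

/-- Modulo 2, the Kirchhoff polynomial takes the values of the tree polynomial. -/
lemma eval_kirchhoff_eq_treeDet {G : SimpleGraph V} (ε : E ≃ G.edgeSet)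
    (hε : ∀ e, (ε e : Sym2 V) = s(s e, t e)) (c : V) (x : G.edgeSet → ZMod 2) :
    MvPolynomial.eval x (MvPolynomial.map (Int.castRingHom (ZMod 2)) (kirchhoff G)) =
      treeDet (incidence s t) (x ∘ ε) c := by
  rw [treeDet_eq_sum, ← Finset.sum_filter, kirchhoff, map_sum, map_sum]
  symm
  refine Finset.sum_bij
    (fun F _ => F.map (ε.toEmbedding.trans (Function.Embedding.subtype _))) ?_ ?_ ?_ ?_
  · intro F hF
    rw [Finset.mem_filter, isSpanningTree_map_iff ε hε c]
    refine ⟨Finset.mem_powerset.2 ?_, (Finset.mem_filter.1 hF).2⟩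
    intro e he
    obtain ⟨e, -, rfl⟩ := Finset.mem_map.1 he
    exact SimpleGraph.mem_edgeFinset.2 (ε e).2
  · intro F _ F' _ h
    exact Finset.map_injective _ h
  · intro T hT
    rw [Finset.mem_filter, Finset.mem_powerset] at hT
    have hmap : (Finset.univ.filter fun e => (ε e : Sym2 V) ∈ T).map
        (ε.toEmbedding.trans (Function.Embedding.subtype _)) = T := by
      ext e
      simp only [Finset.mem_map, Finset.mem_filter, Finset.mem_univ, true_and]
      constructor
      · rintro ⟨e, he, rfl⟩
        exact he
      · intro he
        have := SimpleGraph.mem_edgeFinset.1 (hT.1 he)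
        exact ⟨ε.symm ⟨e, this⟩, by simpa using he, by simp⟩
    refine ⟨_, ?_, hmap⟩
    rw [Finset.mem_filter, ← isSpanningTree_map_iff ε hε c, hmap]
    exact ⟨Finset.mem_univ _, hT.2⟩
  · intro F _
    have hmem : ∀ e, (ε e : Sym2 V) ∈
        F.map (ε.toEmbedding.trans (Function.Embedding.subtype _)) ↔ e ∈ F := fun e =>
      Finset.mem_map' (ε.toEmbedding.trans (Function.Embedding.subtype _))
    rw [map_prod, map_prod, ← ε.prod_comp, ← Finset.prod_subset (Finset.subset_univ Fᶜ)]
    · refine Finset.prod_congr rfl fun e he => ?_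
      rw [if_neg (mt (hmem e).1 (Finset.mem_compl.1 he))]
      simp
    · intro e _ he
      rw [if_pos ((hmem e).2 (by simpa using he))]
      simp

end KirchhoffPolynomial

section StarExtension

open Matrix

variable {E V : Type*} [Fintype E] [DecidableEq E] [Fintype V] [DecidableEq V]

/-- First endpoints of the network obtained by joining a new vertex to three terminals. -/
def starSource (s : E → V) : E ⊕ Fin 3 → Option V :=
  Sum.elim (some ∘ s) fun _ => none

/-- Second endpoints of the network obtained by joining a new vertex to three terminals. -/
def starTarget (t : E → V) (a b c : V) : E ⊕ Fin 3 → Option V :=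
  Sum.elim (some ∘ t) (some ∘ ![a, b, c])

lemma star_divergence_some (s t : E → V) (a b c : V) (Y : E ⊕ Fin 3 → ZMod 2) (v : V) :
    ((incidence (starSource s) (starTarget t a b c))ᵀ *ᵥ Y) (some v) =
      ((incidence s t)ᵀ *ᵥ (Y ∘ Sum.inl)) v + ((if v = a then Y (Sum.inr 0) else 0) +
        (if v = b then Y (Sum.inr 1) else 0) + if v = c then Y (Sum.inr 2) else 0) := by
  simp only [mulVec, dotProduct, Fintype.sum_sum_type, Fin.sum_univ_three]
  simp [incidence, starSource, starTarget, Pi.single_apply]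

lemma star_ker_iff (s t : E → V) {a b c : V} (hab : a ≠ b) (hac : a ≠ c) (hbc : b ≠ c)
    (W : (E ⊕ Fin 3) ⊕ Option V → ZMod 2) (y : E → ZMod 2) (α₁ α₂ α₃ : ZMod 2) :
    (expandedLaplacian (incidence (starSource s) (starTarget t a b c))
      (Sum.elim y ![α₁, α₂, α₃])).updateRow (Sum.inr none) (Pi.single (Sum.inr none) 1) *ᵥ W = 0 ↔
    ((∀ e, y e * W (Sum.inl (Sum.inl e)) +
        (W (Sum.inr (some (s e))) + W (Sum.inr (some (t e)))) = 0) ∧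
      (∀ v, v ≠ a → v ≠ b → v ≠ c →
        ((incidence s t)ᵀ *ᵥ ((W ∘ Sum.inl) ∘ Sum.inl)) v = 0) ∧
      (α₁ * W (Sum.inl (Sum.inr 0)) + W (Sum.inr (some a)) = 0 ∧
        α₂ * W (Sum.inl (Sum.inr 1)) + W (Sum.inr (some b)) = 0 ∧
        α₃ * W (Sum.inl (Sum.inr 2)) + W (Sum.inr (some c)) = 0)) ∧
      (((incidence s t)ᵀ *ᵥ ((W ∘ Sum.inl) ∘ Sum.inl)) a = W (Sum.inl (Sum.inr 0)) ∧
        ((incidence s t)ᵀ *ᵥ ((W ∘ Sum.inl) ∘ Sum.inl)) b = W (Sum.inl (Sum.inr 1)) ∧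
        ((incidence s t)ᵀ *ᵥ ((W ∘ Sum.inl) ∘ Sum.inl)) c = W (Sum.inl (Sum.inr 2))) ∧
      W (Sum.inr none) = 0 := by
  rw [treeDet_ker_iff, Sum.forall, Option.forall]
  simp only [incidence_mulVec, star_divergence_some]
  simp only [starSource, starTarget, Sum.elim_inl, Sum.elim_inr, Function.comp_apply,
    Fin.forall_fin_succ]
  constructor
  · rintro ⟨⟨h1, h2⟩, ⟨-, h3⟩, h4⟩
    refine ⟨⟨h1, fun v ha hb hc => ?_, ?_⟩, ⟨?_, ?_, ?_⟩, h4⟩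
    · simpa [ha, hb, hc] using h3 v (by simp)
    · simpa [h4] using h2
    · exact CharTwo.add_eq_zero.1 (by simpa [hab, hac] using h3 a (by simp))
    · exact CharTwo.add_eq_zero.1 (by simpa [hab.symm, hbc] using h3 b (by simp))
    · exact CharTwo.add_eq_zero.1 (by simpa [hac.symm, hbc.symm] using h3 c (by simp))
  · rintro ⟨⟨h1, h3, h2⟩, ⟨ha, hb, hc⟩, h4⟩
    refine ⟨⟨h1, ?_⟩, ⟨by simp, fun v _ => ?_⟩, h4⟩
    · simpa [h4] using h2
    · by_cases hva : v = a
      · subst hva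
        simpa [hab, hac] using CharTwo.add_eq_zero.2 ha
      by_cases hvb : v = b
      · subst hvb
        simpa [hab.symm, hbc] using CharTwo.add_eq_zero.2 hb
      by_cases hvc : v = c
      · subst hvc
        simpa [hac.symm, hbc.symm] using CharTwo.add_eq_zero.2 hc
      simpa [hva, hvb, hvc] using h3 v hva hvb hvc

lemma terminal_rows_ker_iff (s t : E → V) {a b c : V} (hab : a ≠ b) (hac : a ≠ c) (hbc : b ≠ c)
    (w : E ⊕ V → ZMod 2) (y : E → ZMod 2) (α₁ α₂ α₃ : ZMod 2) :
    (((expandedLaplacian (incidence s t) y).updateRow (Sum.inr a)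
        (α₁ • expandedLaplacian (incidence s t) y (Sum.inr a) +
          Pi.single (Sum.inr a) 1)).updateRow (Sum.inr b)
        (α₂ • expandedLaplacian (incidence s t) y (Sum.inr b) +
          Pi.single (Sum.inr b) 1)).updateRow (Sum.inr c)
        (α₃ • expandedLaplacian (incidence s t) y (Sum.inr c) +
          Pi.single (Sum.inr c) 1) *ᵥ w = 0 ↔
    (∀ e, y e * w (Sum.inl e) + (w (Sum.inr (s e)) + w (Sum.inr (t e))) = 0) ∧
      (∀ v, v ≠ a → v ≠ b → v ≠ c → ((incidence s t)ᵀ *ᵥ (w ∘ Sum.inl)) v = 0) ∧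
      (α₁ * ((incidence s t)ᵀ *ᵥ (w ∘ Sum.inl)) a + w (Sum.inr a) = 0 ∧
        α₂ * ((incidence s t)ᵀ *ᵥ (w ∘ Sum.inl)) b + w (Sum.inr b) = 0 ∧
        α₃ * ((incidence s t)ᵀ *ᵥ (w ∘ Sum.inl)) c + w (Sum.inr c) = 0) := by
  rw [updateRow_mulVec, updateRow_mulVec, updateRow_mulVec, add_dotProduct, add_dotProduct,
    add_dotProduct, smul_dotProduct, smul_dotProduct, smul_dotProduct, single_one_dotProduct,
    single_one_dotProduct, single_one_dotProduct, expandedLaplacian_inr_dotProduct,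
    expandedLaplacian_inr_dotProduct, expandedLaplacian_inr_dotProduct, funext_iff, Sum.forall]
  refine and_congr (forall_congr' fun e => ?_) ⟨fun h => ⟨fun v ha hb hc => ?_, ?_, ?_, ?_⟩, ?_⟩
  · simp [expandedLaplacian_mulVec_inl, incidence_mulVec]
  · simpa [ha, hb, hc, expandedLaplacian_mulVec_inr] using h v
  · simpa [hab, hac] using h a
  · simpa [hbc] using h b
  · simpa using h c
  · rintro ⟨h, ha, hb, hc⟩ v
    by_cases hvc : v = c
    · subst hvc
      simpa using hc
    by_cases hvb : v = b
    · subst hvb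
      simpa [hbc] using hb
    by_cases hva : v = a
    · subst hva
      simpa [hab, hac] using ha
    simpa [hva, hvb, hvc, expandedLaplacian_mulVec_inr] using h v hva hvb hvc

/-- Eliminating the star edges from the tree polynomial. -/
lemma treeDet_star (s t : E → V) {a b c : V} (hab : a ≠ b) (hac : a ≠ c) (hbc : b ≠ c)
    (y : E → ZMod 2) (α₁ α₂ α₃ : ZMod 2) :
    treeDet (incidence (starSource s) (starTarget t a b c)) (Sum.elim y ![α₁, α₂, α₃]) none =
    ((((expandedLaplacian (incidence s t) y).updateRow (Sum.inr a)
        (α₁ • expandedLaplacian (incidence s t) y (Sum.inr a) +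
          Pi.single (Sum.inr a) 1)).updateRow (Sum.inr b)
        (α₂ • expandedLaplacian (incidence s t) y (Sum.inr b) +
          Pi.single (Sum.inr b) 1)).updateRow (Sum.inr c)
        (α₃ • expandedLaplacian (incidence s t) y (Sum.inr c) +
          Pi.single (Sum.inr c) 1)).det := by
  refine det_eq_det_of_ker_iff ?_
  simp only [star_ker_iff s t hab hac hbc, terminal_rows_ker_iff s t hab hac hbc]
  constructor
  · intro h w hw
    let d := (incidence s t)ᵀ *ᵥ fun e => w (Sum.inl e)
    have := h (Sum.elim (Sum.elim (fun e => w (Sum.inl e)) ![d a, d b, d c])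
      (fun v => v.elim 0 fun v => w (Sum.inr v))) ⟨hw, ⟨rfl, rfl, rfl⟩, rfl⟩
    ext (e | v)
    · exact congrFun this (Sum.inl (Sum.inl e))
    · exact congrFun this (Sum.inr (some v))
  · rintro h W ⟨hW, ⟨ha, hb, hc⟩, h0⟩
    have := h (Sum.elim ((W ∘ Sum.inl) ∘ Sum.inl) fun v => W (Sum.inr (some v)))
      (by
        simp only [Sum.elim_comp_inl, Sum.elim_inl, Sum.elim_inr, ha, hb, hc]
        exact hW)
    have hE : (W ∘ Sum.inl) ∘ Sum.inl = 0 :=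
      funext fun e => congrFun this (Sum.inl e)
    rw [hE, mulVec_zero] at ha hb hc
    ext ((e | i) | (_ | v))
    · exact congrFun hE e
    · fin_cases i
      exacts [ha.symm, hb.symm, hc.symm]
    · exact h0
    · exact congrFun this (Sum.inr v)

end StarExtension

section StarCount

open Matrix

variable {E V : Type*} [Fintype E] [DecidableEq E] [Fintype V] [DecidableEq V]

lemma card_star_form_zeros : ∀ f₀ f₁ f₂ f₃ t : ZMod 2,
    f₀ * t = f₁ * f₂ + f₁ * f₃ + f₂ * f₃ →
      (Finset.univ.filter fun α : ZMod 2 × ZMod 2 × ZMod 2 =>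
        f₀ * (α.1 * α.2.1 + α.1 * α.2.2 + α.2.1 * α.2.2) + α.1 * (f₂ + f₃) + α.2.1 * (f₁ + f₃) +
          α.2.2 * (f₁ + f₂) + t = 0).card ≡ 4 * (f₀ + (1 + f₀) * (f₁ + f₂ + f₃)).val [MOD 8] := by
  decide

/-- The star resistances as an explicit triple. -/
def starAssignmentEquiv : (E → ZMod 2) × ZMod 2 × ZMod 2 × ZMod 2 ≃ (E ⊕ Fin 3 → ZMod 2) where
  toFun p := Sum.elim p.1 ![p.2.1, p.2.2.1, p.2.2.2]
  invFun x := (x ∘ Sum.inl, x (Sum.inr 0), x (Sum.inr 1), x (Sum.inr 2))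
  left_inv p := by simp
  right_inv x := by
    ext (e | i)
    · rfl
    · fin_cases i <;> rfl

/-- The zero count of the tree polynomial of a star extension, in terms of the network. -/
lemma card_treeDet_star_zeros (s t : E → V) {a b c : V} (hab : a ≠ b) (hac : a ≠ c) (hbc : b ≠ c)
    (hsum : ∑ y, (treeDet (incidence s t) y c + (1 + treeDet (incidence s t) y c) *
      (forestDet (incidence s t) y a b c + forestDet (incidence s t) y b a c +
        forestDet (incidence s t) y c a b)) = 0) :
    Nat.card {x : E ⊕ Fin 3 → ZMod 2 //
      treeDet (incidence (starSource s) (starTarget t a b c)) x none = 0} % 8 = 0 := by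
  have hk : ∀ y, expandedLaplacian (incidence s t) y *ᵥ (Sum.elim 0 1 : E ⊕ V → ZMod 2) = 0 := by
    intro y
    ext (e | v)
    · simp [expandedLaplacian_mulVec_inl, incidence_mulVec, CharTwo.add_self_eq_zero]
    · simp [expandedLaplacian_mulVec_inr]
  have hcount : ∀ y : E → ZMod 2, (Finset.univ.filter fun α : ZMod 2 × ZMod 2 × ZMod 2 =>
      treeDet (incidence (starSource s) (starTarget t a b c))
        (Sum.elim y ![α.1, α.2.1, α.2.2]) none = 0).card ≡
      4 * (treeDet (incidence s t) y c + (1 + treeDet (incidence s t) y c) *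
      (forestDet (incidence s t) y a b c + forestDet (incidence s t) y b a c +
        forestDet (incidence s t) y c a b)).val [MOD 8] := by
    intro y
    obtain ⟨τ, hτ, hdet⟩ := exists_det_star (expandedLaplacian_isSymm (incidence s t) y) (hk y)
      (a := Sum.inr a) (b := Sum.inr b) (c := Sum.inr c) rfl rfl rfl
      (Sum.inr_injective.ne hab) (Sum.inr_injective.ne hac) (Sum.inr_injective.ne hbc)
      (f₀ := treeDet (incidence s t) y c) (f₁ := forestDet (incidence s t) y a b c)
      (f₂ := forestDet (incidence s t) y b a c) (f₃ := forestDet (incidence s t) y c a b)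
      rfl rfl rfl rfl
    simp_rw [treeDet_star s t hab hac hbc, hdet]
    exact card_star_form_zeros _ _ _ _ _ hτ
  set p : (E → ZMod 2) → ZMod 2 := fun y => treeDet (incidence s t) y c +
    (1 + treeDet (incidence s t) y c) * (forestDet (incidence s t) y a b c +
      forestDet (incidence s t) y b a c + forestDet (incidence s t) y c a b)
  have hcard : Nat.card {x : E ⊕ Fin 3 → ZMod 2 //
      treeDet (incidence (starSource s) (starTarget t a b c)) x none = 0} =
      ∑ y : E → ZMod 2, (Finset.univ.filter fun α : ZMod 2 × ZMod 2 × ZMod 2 =>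
      treeDet (incidence (starSource s) (starTarget t a b c))
        (Sum.elim y ![α.1, α.2.1, α.2.2]) none = 0).card := by
    rw [← Nat.card_congr (starAssignmentEquiv.subtypeEquiv fun _ => Iff.rfl),
      Nat.card_eq_fintype_card, Fintype.card_subtype, Finset.card_filter, Fintype.sum_prod_type]
    simp_rw [Finset.card_filter]
    rfl
  have hmod : (∑ y, 4 * (p y).val) ≡ 0 [MOD 8] := by
    have h2 : 2 ∣ ∑ y, (p y).val := by
      rw [← ZMod.natCast_eq_zero_iff, Nat.cast_sum]
      simpa using hsum
    rw [← Finset.mul_sum]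
    exact (Nat.modEq_zero_iff_dvd).2 (mul_dvd_mul_left 4 h2)
  rw [hcard]
  refine Nat.ModEq.trans ?_ hmod
  exact Nat.ModEq.sum fun y _ => hcount y

end StarCount

section NetworkSums

open Matrix

variable {E V : Type*} [Fintype E] [DecidableEq E] [Fintype V] [DecidableEq V]

lemma sum_prod_zmod_two (S : Finset E) :
    ∑ x : E → ZMod 2, ∏ e ∈ S, x e = if S = Finset.univ then 1 else 0 := by
  have h : ∀ x : E → ZMod 2, ∏ e ∈ S, x e = ∏ e, if e ∈ S then x e else 1 := fun x => by
    rw [Finset.prod_ite_mem, Finset.univ_inter]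
  have h1 : ∀ e, ∑ a : ZMod 2, (if e ∈ S then a else 1) = if e ∈ S then 1 else 0 := fun e => by
    by_cases he : e ∈ S <;> simp only [he, if_true, if_false] <;> decide
  simp_rw [h]
  rw [← Fintype.piFinset_univ, ← Finset.prod_univ_sum (fun _ => Finset.univ)
    fun e (a : ZMod 2) => if e ∈ S then a else 1]
  simp_rw [h1]
  rw [Finset.prod_boole]
  simp [Finset.eq_univ_iff_forall]

lemma sum_prod_compl_mul (T F : Finset E) :
    ∑ x : E → ZMod 2, (∏ e ∈ Tᶜ, x e) * ∏ e ∈ Fᶜ, x e = if Disjoint T F then 1 else 0 := by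
  have h : ∀ x : E → ZMod 2, (∏ e ∈ Tᶜ, x e) * ∏ e ∈ Fᶜ, x e = ∏ e ∈ Tᶜ ∪ Fᶜ, x e := fun x => by
    have hsq : ∏ e ∈ Tᶜ ∩ Fᶜ, x e = (∏ e ∈ Tᶜ ∩ Fᶜ, x e) * ∏ e ∈ Tᶜ ∩ Fᶜ, x e := by
      generalize ∏ e ∈ Tᶜ ∩ Fᶜ, x e = a
      revert a
      decide
    rw [← Finset.prod_union_inter, ← Finset.prod_sdiff (Finset.inter_subset_union), mul_assoc,
      ← hsq]
  simp_rw [h, sum_prod_zmod_two, ← Finset.compl_inter, Finset.compl_eq_univ_iff,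
    Finset.disjoint_iff_inter_eq_empty]

lemma sum_treeDet {s t : E → V} {c : V} (hc : ∃ v, v ≠ c) :
    ∑ x, treeDet (incidence s t) x c = 0 := by
  obtain ⟨v, hv⟩ := hc
  simp_rw [treeDet_eq_sum]
  rw [Finset.sum_comm]
  refine Finset.sum_eq_zero fun F _ => ?_
  split_ifs with h
  · rw [sum_prod_zmod_two, if_neg]
    rw [Finset.compl_eq_univ_iff]
    rintro rfl
    simpa using congrFun (h.1 (Pi.single v 1) (by simp [hv.symm]) (by simp)) v
  · simp

lemma sum_forestDet {s t : E → V} {p q r : V} (hpr : p ≠ r) (hc : ∃ v, v ≠ p ∧ v ≠ q) :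
    ∑ x, forestDet (incidence s t) x p q r = 0 := by
  obtain ⟨v, hp, hq⟩ := hc
  simp_rw [forestDet_eq_sum _ _ _ hpr]
  rw [Finset.sum_comm]
  refine Finset.sum_eq_zero fun F _ => ?_
  split_ifs with h
  · rw [sum_prod_zmod_two, if_neg]
    rw [Finset.compl_eq_univ_iff]
    rintro rfl
    simpa using congrFun (h.1 (Pi.single v 1) (by simp [hp.symm]) (by simp [hq.symm]) (by simp)) v
  · simp

lemma sum_treeDet_mul_forestDet (s t : E → V) (c : V) {p r : V} (q : V) (hpr : p ≠ r) :
    ∑ x, treeDet (incidence s t) x c * forestDet (incidence s t) x p q r =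
      ∑ P : Finset E × Finset E, if IsTreeSet (incidence s t) c P.1 ∧
        IsForestSet (incidence s t) p q r P.2 ∧ Disjoint P.1 P.2 then 1 else 0 := by
  simp_rw [treeDet_eq_sum, forestDet_eq_sum _ _ _ hpr, Finset.sum_mul_sum]
  rw [Finset.sum_comm, Fintype.sum_prod_type]
  refine Finset.sum_congr rfl fun T _ => ?_
  rw [Finset.sum_comm]
  refine Finset.sum_congr rfl fun F _ => ?_
  by_cases hT : IsTreeSet (incidence s t) c T <;>
    by_cases hF : IsForestSet (incidence s t) p q r F <;>
      simp [hT, hF, sum_prod_compl_mul]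

lemma IsTreeSet.card_le {s t : E → V} {c : V} {T : Finset E}
    (h : IsTreeSet (incidence s t) c T) : Fintype.card V ≤ T.card + 1 := by
  have hinj : Function.Injective fun z : V → ZMod 2 =>
      (z c, fun e : T => (incidence s t *ᵥ z) e) := by
    intro z z' hz
    rw [Prod.mk.injEq] at hz
    rw [← sub_eq_zero]
    refine h.1 _ (by simp [hz.1]) fun e he => ?_
    have := congrFun hz.2 ⟨e, he⟩
    simpa [mulVec_sub, sub_eq_zero] using this
  have := Fintype.card_le_of_injective _ hinj
  simp only [Fintype.card_fun, ZMod.card, Fintype.card_prod, Fintype.card_coe] at this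
  rw [mul_comm, ← pow_succ] at this
  exact (Nat.pow_le_pow_iff_right (by simp)).1 this

lemma IsForestSet.card_le {s t : E → V} {p q r : V} {F : Finset E}
    (h : IsForestSet (incidence s t) p q r F) : Fintype.card V ≤ F.card + 2 := by
  have hinj : Function.Injective fun z : V → ZMod 2 =>
      (z p, z q, fun e : F => (incidence s t *ᵥ z) e) := by
    intro z z' hz
    rw [Prod.mk.injEq, Prod.mk.injEq] at hz
    rw [← sub_eq_zero]
    refine h.1 _ (by simp [hz.1]) (by simp [hz.2.1]) fun e he => ?_
    have := congrFun hz.2.2 ⟨e, he⟩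
    simpa [mulVec_sub, sub_eq_zero] using this
  have := Fintype.card_le_of_injective _ hinj
  simp only [Fintype.card_fun, ZMod.card, Fintype.card_prod, Fintype.card_coe] at this
  rw [mul_comm, mul_comm 2, ← pow_succ, ← pow_succ] at this
  exact (Nat.pow_le_pow_iff_right (by simp)).1 this

end NetworkSums

section NetworkSymmetry

open Matrix

variable {E V : Type*} [Fintype E] [DecidableEq E] [Fintype V] [DecidableEq V]

lemma incidence_submatrix {E' V' : Type*} [DecidableEq V'] {s t : E → V} {s' t' : E' → V'}
    {φ : E' ≃ E} {ψ : V' ≃ V} (h : ∀ e, s(s (φ e), t (φ e)) = s(ψ (s' e), ψ (t' e))) :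
    (incidence s t).submatrix φ ψ = incidence s' t' := by
  ext e v
  rcases Sym2.eq_iff.1 (h e) with ⟨h1, h2⟩ | ⟨h1, h2⟩ <;>
    simp [incidence, h1, h2, Pi.single_apply, add_comm]

lemma single_eq_zero_of_mem {F : Finset E} {e e' : E} (h : e' ∈ F) (he : e ∉ F) :
    (Pi.single e' 1 : E → ZMod 2) e = 0 :=
  Pi.single_eq_of_ne (ne_of_mem_of_not_mem h he).symm _

lemma divergence_comp {s t : E → V} {φ : E ≃ E} {ψ : V ≃ V}
    (h : (incidence s t).submatrix φ ψ = incidence s t) (y : E → ZMod 2) :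
    (incidence s t)ᵀ *ᵥ (y ∘ φ) = ((incidence s t)ᵀ *ᵥ y) ∘ ψ := by
  conv_lhs => rw [← h, transpose_submatrix, submatrix_mulVec_equiv]
  simp [Function.comp_assoc]

lemma single_comp_equiv (ψ : V ≃ V) {a b : V} (h : ψ b = a) :
    (Pi.single a 1 : V → ZMod 2) ∘ ψ = Pi.single b 1 := by
  ext v
  simp [Pi.single_apply, ← h]

/-- If a spanning 2-forest isolates `p`, then it separates `p` from any two vertices. -/
lemma IsForestSet.of_isolated {s t : E → V} {p q r q' r' : V} {F : Finset E}
    (h : IsForestSet (incidence s t) p q r F) (hiso : ∀ e ∈ F, s e ≠ p ∧ t e ≠ p)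
    (hq : q ≠ p) (hq' : q' ≠ p) :
    IsForestSet (incidence s t) p q' r' F := by
  refine ⟨fun z hzp hzq hz => ?_, fun y hy hdiv => ?_⟩
  · have key := h.1 (fun v => z v + if v = p then 0 else z q) (by simp [hzp])
      (by simp [hq, CharTwo.add_self_eq_zero]) fun e he => by
        have := hz e he
        rw [incidence_mulVec] at this ⊢
        rw [if_neg (hiso e he).1, if_neg (hiso e he).2, add_add_add_comm, this, zero_add,
          CharTwo.add_self_eq_zero]
    have hzero : z q = 0 := by simpa [hzq, hq'] using congrFun key q'
    ext v
    simpa [hzero] using congrFun key v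
  · have hp : ((incidence s t)ᵀ *ᵥ y) p = 0 := by
      refine Finset.sum_eq_zero fun e _ => ?_
      by_cases he : e ∈ F
      · simp [incidence, Pi.single_eq_of_ne' (hiso e he).1, Pi.single_eq_of_ne' (hiso e he).2]
      · rw [hy e he, mul_zero]
    have hr : ((incidence s t)ᵀ *ᵥ y) r' = 0 := by
      rw [← sum_divergence s t y]
      refine (Finset.sum_eq_single_of_mem r' (Finset.mem_univ r') fun v _ hv => ?_).symm
      by_cases hvp : v = p
      · rw [hvp, hp]
      · exact hdiv v hvp hv
    refine h.2 y hy fun v hv _ => ?_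
    by_cases hvr : v = r'
    · rw [hvr, hr]
    · exact hdiv v hv hvr

end NetworkSymmetry

section Grid

open Matrix

/-- The vertices of the toroidal grid of width 3 without a removed vertex `v` and its neighbour
`v + (0, 1)`: the vertex `v + (0, 2)`, and the vertices `v + (i + 1, j)`. -/
abbrev GridVertex (m : ℕ) := Option (Fin (m + 2) × ZMod 3)

/-- The edges between the vertices of the toroidal grid: those within the 3-cycles, those between
consecutive 3-cycles, and the two edges at `v + (0, 2)`. -/
abbrev GridEdge (m : ℕ) := (Fin (m + 2) × ZMod 3) ⊕ (Fin (m + 1) × ZMod 3) ⊕ Bool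

/-- First endpoints of the edges of the toroidal grid. -/
def gridSource (m : ℕ) : GridEdge m → GridVertex m :=
  Sum.elim (fun p => some (p.1, p.2 + 1))
    (Sum.elim (fun p => some (p.1.castSucc, p.2)) fun _ => none)

/-- Second endpoints of the edges of the toroidal grid. -/
def gridTarget (m : ℕ) : GridEdge m → GridVertex m :=
  Sum.elim (fun p => some (p.1, p.2 + 2))
    (Sum.elim (fun p => some (p.1.succ, p.2)) fun i => some (if i then Fin.last _ else 0, 2))

/-- The incidence matrix of the toroidal grid. -/
abbrev gridMatrix (m : ℕ) : Matrix (GridEdge m) (GridVertex m) (ZMod 2) :=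
  incidence (gridSource m) (gridTarget m)

/-- The reflection of the vertices reversing the order of the 3-cycles. -/
def reflectVertex (m : ℕ) : GridVertex m ≃ GridVertex m :=
  (Fin.revPerm.prodCongr (Equiv.refl _)).optionCongr

/-- The reflection of the edges reversing the order of the 3-cycles. -/
def reflectEdge (m : ℕ) : GridEdge m ≃ GridEdge m :=
  (Fin.revPerm.prodCongr (Equiv.refl _)).sumCongr
    ((Fin.revPerm.prodCongr (Equiv.refl _)).sumCongr Equiv.boolNot)

/-- The exchange of the first two vertices of each of the 3-cycles. -/
def swapVertex (m : ℕ) : GridVertex m ≃ GridVertex m :=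
  ((Equiv.refl _).prodCongr (Equiv.subLeft 1)).optionCongr

/-- The effect on edges of exchanging the first two vertices of each of the 3-cycles. -/
def swapEdge (m : ℕ) : GridEdge m ≃ GridEdge m :=
  ((Equiv.refl _).prodCongr (Equiv.subLeft 1)).sumCongr
    (((Equiv.refl _).prodCongr (Equiv.subLeft 1)).sumCongr (Equiv.refl _))

variable {m : ℕ}

lemma gridMatrix_reflect : (gridMatrix m).submatrix (reflectEdge m) (reflectVertex m) =
    gridMatrix m := by
  refine incidence_submatrix ?_
  rintro (⟨i, j⟩ | ⟨i, j⟩ | (_ | _)) <;>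
    simp [gridSource, gridTarget, reflectEdge, reflectVertex, Fin.rev_castSucc, Fin.rev_succ]

lemma gridMatrix_swap : (gridMatrix m).submatrix (swapEdge m) (swapVertex m) = gridMatrix m := by
  refine incidence_submatrix ?_
  have h1 : ∀ j : ZMod 3, 1 - j + 1 = 1 - (j + 2) := by decide
  have h2 : ∀ j : ZMod 3, 1 - j + 2 = 1 - (j + 1) := by decide
  have h3 : (2 : ZMod 3) = 1 - 2 := by decide
  rintro (⟨i, j⟩ | ⟨i, j⟩ | (_ | _))
  · simp [gridSource, gridTarget, swapEdge, swapVertex, h1, h2]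
  · simp [gridSource, gridTarget, swapEdge, swapVertex]
  · simp [gridSource, gridTarget, swapEdge, swapVertex, ← h3]
  · simp [gridSource, gridTarget, swapEdge, swapVertex, ← h3]

lemma reflectEdge_involutive : Function.Involutive (reflectEdge m) := by
  rintro (⟨i, j⟩ | ⟨i, j⟩ | (_ | _)) <;> simp [reflectEdge]

lemma swapEdge_involutive : Function.Involutive (swapEdge m) := by
  rintro (⟨i, j⟩ | ⟨i, j⟩ | (_ | _)) <;> simp [swapEdge]

/-- A tree and a forest of the grid which partition the edges are not both symmetric under the
exchange of two columns if the forest isolates the removed neighbour. -/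
lemma not_forall_mem_or_mem_of_swap {T F : Finset (GridEdge m)}
    (hT : ∀ y : GridEdge m → ZMod 2, (∀ e ∉ T, y e = 0) → (gridMatrix m)ᵀ *ᵥ y = 0 → y = 0)
    (hF : ∀ y : GridEdge m → ZMod 2, (∀ e ∉ F, y e = 0) → (gridMatrix m)ᵀ *ᵥ y = 0 → y = 0)
    (hconn : ∀ a b, (edgeGraph (gridSource m) (gridTarget m) T).Reachable a b)
    (hTs : ∀ e, swapEdge m e ∈ T ↔ e ∈ T) (hFs : ∀ e, swapEdge m e ∈ F ↔ e ∈ F)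
    (h : ∀ e, e ∈ T ∨ e ∈ F) : False := by
  have hswap2 : (1 - 2 : ZMod 3) = 2 := by decide
  have h12 : (1 + 2 : ZMod 3) = 0 := by decide
  have h22 : (2 + 2 : ZMod 3) = 1 := by decide
  have h11 : (1 + 1 : ZMod 3) = 2 := by decide
  have h21 : (2 + 1 : ZMod 3) = 0 := by decide
  have two : (2 : ZMod 2) = 0 := rfl
  have hcol : ∀ i, (Sum.inl (i, 2) : GridEdge m) ∈ F := by
    intro i
    by_contra hi
    have hi := (h _).resolve_right hi
    obtain ⟨p, hp, hdiv⟩ := exists_flow_of_reachable (hconn (some (i, 0)) (some (i, 2)))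
    have := hT (p + p ∘ swapEdge m + Pi.single (Sum.inl (i, 2)) 1) (fun e he => ?_) ?_
    · have := congrFun this (Sum.inl (i, 2))
      simp [swapEdge, hswap2, CharTwo.add_self_eq_zero] at this
    · simp [hp e he, hp _ (mt (hTs e).1 he), single_eq_zero_of_mem hi he]
    · rw [mulVec_add, mulVec_add, divergence_comp gridMatrix_swap, hdiv, divergence_single]
      have hc : (Pi.single (some (i, 0)) 1 + Pi.single (some (i, 2)) 1 : GridVertex m → ZMod 2) ∘
          swapVertex m = Pi.single (some (i, 1)) 1 + Pi.single (some (i, 2)) 1 := by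
        rw [Pi.add_comp, single_comp_equiv _ (b := some (i, 1)),
          single_comp_equiv _ (b := some (i, 2))]
        · simp [swapVertex, hswap2]
        · simp [swapVertex]
      rw [hc]
      ext v
      simp only [gridSource, gridTarget, Sum.elim_inl, h21, h22, Pi.add_apply, Pi.zero_apply]
      linear_combination ((Pi.single (some (i, 0)) 1 : GridVertex m → ZMod 2) v +
        (Pi.single (some (i, 1)) 1 : GridVertex m → ZMod 2) v +
        (Pi.single (some (i, 2)) 1 : GridVertex m → ZMod 2) v) * two
  have hrow : ∀ i, swapEdge m (Sum.inr (Sum.inl (i, 0))) = Sum.inr (Sum.inl (i, 1)) := fun i => by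
    simp [swapEdge]
  have hlayer : ∀ i, swapEdge m (Sum.inl (i, 0)) = Sum.inl (i, 1) := fun i => by
    simp [swapEdge]
  have hr0 : (Sum.inr (Sum.inl (0, 0)) : GridEdge m) ∈ T := by
    by_contra h0
    have h0 := (h _).resolve_left h0
    have h1 := (hFs _).2 h0
    rw [hrow] at h1
    have := hF (Pi.single (Sum.inl (0, 2)) 1 + Pi.single (Sum.inl (1, 2)) 1 +
      Pi.single (Sum.inr (Sum.inl (0, 0))) 1 + Pi.single (Sum.inr (Sum.inl (0, 1))) 1)
      (fun e he => ?_) ?_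
    · simpa using congrFun this (Sum.inl (0, 2))
    · simp [single_eq_zero_of_mem (hcol 0) he, single_eq_zero_of_mem (hcol 1) he,
        single_eq_zero_of_mem h0 he, single_eq_zero_of_mem h1 he]
    · simp only [mulVec_add, divergence_single]
      ext v
      simp only [gridSource, gridTarget, Sum.elim_inl, Sum.elim_inr, h21, h22, Pi.add_apply,
        Pi.zero_apply, Fin.castSucc_zero, Fin.succ_zero_eq_one]
      linear_combination ((Pi.single (some (0, 0)) 1 : GridVertex m → ZMod 2) v +
        (Pi.single (some (0, 1)) 1 : GridVertex m → ZMod 2) v +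
        (Pi.single (some (1, 0)) 1 : GridVertex m → ZMod 2) v +
        (Pi.single (some (1, 1)) 1 : GridVertex m → ZMod 2) v) * two
  have hr1 := hrow 0 ▸ (hTs _).2 hr0
  have hh0 : ∀ i, (Sum.inl (i, 0) : GridEdge m) ∈ T := by
    intro i
    by_contra h0
    have h0 := (h _).resolve_left h0
    have h1 := (hFs _).2 h0
    rw [hlayer] at h1
    have := hF (Pi.single (Sum.inl (i, 2)) 1 + Pi.single (Sum.inl (i, 1)) 1 +
      Pi.single (Sum.inl (i, 0)) 1) (fun e he => ?_) ?_
    · simpa [show (0 : ZMod 3) ≠ 2 by decide] using congrFun this (Sum.inl (i, 0))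
    · simp [single_eq_zero_of_mem (hcol i) he, single_eq_zero_of_mem h0 he,
        single_eq_zero_of_mem h1 he]
    · simp only [mulVec_add, divergence_single]
      ext v
      simp only [gridSource, gridTarget, Sum.elim_inl, h21, h22, h11, h12, zero_add, Pi.add_apply,
        Pi.zero_apply]
      linear_combination ((Pi.single (some (i, 0)) 1 : GridVertex m → ZMod 2) v +
        (Pi.single (some (i, 1)) 1 : GridVertex m → ZMod 2) v +
        (Pi.single (some (i, 2)) 1 : GridVertex m → ZMod 2) v) * two
  have hh1 : ∀ i, (Sum.inl (i, 1) : GridEdge m) ∈ T := fun i => hlayer i ▸ (hTs _).2 (hh0 i)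
  have := hT (Pi.single (Sum.inl (0, 0)) 1 + Pi.single (Sum.inl (0, 1)) 1 +
    Pi.single (Sum.inl (1, 0)) 1 + Pi.single (Sum.inl (1, 1)) 1 +
    Pi.single (Sum.inr (Sum.inl (0, 0))) 1 + Pi.single (Sum.inr (Sum.inl (0, 1))) 1)
    (fun e he => ?_) ?_
  · simpa using congrFun this (Sum.inr (Sum.inl (0, 0)))
  · simp [single_eq_zero_of_mem (hh0 _) he, single_eq_zero_of_mem (hh1 _) he,
      single_eq_zero_of_mem hr0 he, single_eq_zero_of_mem hr1 he]
  · simp only [mulVec_add, divergence_single]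
    ext v
    simp only [gridSource, gridTarget, Sum.elim_inl, Sum.elim_inr, h11, h12, zero_add,
      Pi.add_apply, Pi.zero_apply, Fin.castSucc_zero, Fin.succ_zero_eq_one]
    linear_combination ((Pi.single (some (0, 0)) 1 : GridVertex m → ZMod 2) v +
      (Pi.single (some (0, 1)) 1 : GridVertex m → ZMod 2) v +
      (Pi.single (some (0, 2)) 1 : GridVertex m → ZMod 2) v +
      (Pi.single (some (1, 0)) 1 : GridVertex m → ZMod 2) v +
      (Pi.single (some (1, 1)) 1 : GridVertex m → ZMod 2) v +
      (Pi.single (some (1, 2)) 1 : GridVertex m → ZMod 2) v) * two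

end Grid

section GridSum

open Matrix

variable {m : ℕ}

/-- The pairs of a spanning tree and a disjoint spanning 2-forest separating the removed
neighbour from the two other terminals. -/
noncomputable def treeForestPairs (m : ℕ) : Finset (Finset (GridEdge m) × Finset (GridEdge m)) :=
  Finset.univ.filter fun P => IsTreeSet (gridMatrix m) none P.1 ∧
    IsForestSet (gridMatrix m) none (some (0, 1)) (some (Fin.last _, 1)) P.2 ∧ Disjoint P.1 P.2

lemma map_reflect_mem_treeForestPairs {P : Finset (GridEdge m) × Finset (GridEdge m)}
    (hP : P ∈ treeForestPairs m) :
    (P.1.map (reflectEdge m).toEmbedding, P.2.map (reflectEdge m).toEmbedding) ∈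
      treeForestPairs m := by
  rw [treeForestPairs, Finset.mem_filter] at hP ⊢
  obtain ⟨-, hT, hF, hd⟩ := hP
  refine ⟨Finset.mem_univ _, ?_, ?_, (Finset.disjoint_map _).2 hd⟩
  · rw [← gridMatrix_reflect, isTreeSet_submatrix] at hT
    simpa [reflectVertex] using hT
  · rw [isForestSet_comm _ (by simp) (by simp), ← gridMatrix_reflect,
      isForestSet_submatrix _ _ _ _ (by simp)] at hF
    simpa [reflectVertex] using hF

lemma map_swap_mem_treeForestPairs {P : Finset (GridEdge m) × Finset (GridEdge m)}
    (hP : P ∈ treeForestPairs m) (hc : ∀ i, Sum.inr (Sum.inr i) ∉ P.2) :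
    (P.1.map (swapEdge m).toEmbedding, P.2.map (swapEdge m).toEmbedding) ∈
      treeForestPairs m := by
  rw [treeForestPairs, Finset.mem_filter] at hP ⊢
  obtain ⟨-, hT, hF, hd⟩ := hP
  refine ⟨Finset.mem_univ _, ?_, ?_, (Finset.disjoint_map _).2 hd⟩
  · rw [← gridMatrix_swap, isTreeSet_submatrix] at hT
    simpa [swapVertex] using hT
  · have hF : IsForestSet (gridMatrix m) none (some (0, 0)) (some (Fin.last _, 0)) P.2 := by
      refine hF.of_isolated (fun e he => ?_) (by simp) (by simp)
      rcases e with (e | e | i)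
      · simp [gridSource, gridTarget]
      · simp [gridSource, gridTarget]
      · exact absurd he (hc i)
    rw [← gridMatrix_swap, isForestSet_submatrix _ _ _ _ (by simp)] at hF
    simpa [swapVertex] using hF

lemma map_reflect_ne {P : Finset (GridEdge m) × Finset (GridEdge m)}
    (hP : P ∈ treeForestPairs m) {i : Bool} (hi : Sum.inr (Sum.inr i) ∈ P.2) :
    P.2.map (reflectEdge m).toEmbedding ≠ P.2 := by
  intro h
  rw [treeForestPairs, Finset.mem_filter] at hP
  obtain ⟨-, hT, -, hd⟩ := hP
  have hi' : (Sum.inr (Sum.inr !i) : GridEdge m) ∈ P.2 := by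
    rw [← h]
    exact Finset.mem_map_of_mem (reflectEdge m).toEmbedding hi
  have hall : ∀ i', (Sum.inr (Sum.inr i') : GridEdge m) ∉ P.1 := fun i' hi'' => by
    rcases Bool.eq_or_eq_not i' i with rfl | rfl
    · exact Finset.disjoint_left.1 hd hi'' hi
    · exact Finset.disjoint_left.1 hd hi'' hi'
  have := hT.1 (fun v => v.elim 0 1) rfl fun e he => ?_
  · simpa using congrFun this (some (0, 0))
  · rw [incidence_mulVec]
    rcases e with (e | e | i')
    · rfl
    · rfl
    · exact absurd he (hall i')

lemma map_swap_ne {P : Finset (GridEdge m) × Finset (GridEdge m)}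
    (hP : P ∈ treeForestPairs m) :
    (P.1.map (swapEdge m).toEmbedding, P.2.map (swapEdge m).toEmbedding) ≠ P := by
  intro h
  obtain ⟨T, F⟩ := P
  rw [Prod.mk.injEq] at h
  rw [treeForestPairs, Finset.mem_filter] at hP
  obtain ⟨-, hT, hF, hd⟩ := hP
  have hinv : ∀ S : Finset (GridEdge m), S.map (swapEdge m).toEmbedding = S →
      ∀ e, swapEdge m e ∈ S ↔ e ∈ S := fun S hS e => by
    conv_lhs => rw [← hS]
    exact Finset.mem_map' _
  refine not_forall_mem_or_mem_of_swap (fun y => hT.divergence_eq_zero)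
    (fun y hy hdiv => hF.2 y hy fun v _ _ => congrFun hdiv v) hT.reachable (hinv T h.1)
    (hinv F h.2) fun e => ?_
  have huniv : T ∪ F = Finset.univ := by
    rw [← Finset.card_eq_iff_eq_univ]
    refine le_antisymm (Finset.card_le_univ _) ?_
    have h1 := hT.card_le
    have h2 := hF.card_le
    rw [Finset.card_union_of_disjoint hd]
    simp only [Fintype.card_option, Fintype.card_prod, Fintype.card_fin, ZMod.card,
      Fintype.card_sum, Fintype.card_bool] at h1 h2 ⊢
    omega
  rw [← Finset.mem_union, huniv]
  exact Finset.mem_univ e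

lemma map_map_of_involutive {E : Type*} {φ : E ≃ E} (h : Function.Involutive φ) (S : Finset E) :
    (S.map φ.toEmbedding).map φ.toEmbedding = S := by
  ext e
  have hsymm : ∀ e, φ.symm e = φ e := fun e => by rw [Equiv.symm_apply_eq, h e]
  simp [hsymm]

/-- The number of pairs of a spanning tree and a disjoint spanning 2-forest is even. -/
lemma card_treeForestPairs (m : ℕ) : ((treeForestPairs m).card : ZMod 2) = 0 := by
  rw [Finset.cast_card]
  have hrefl : ∀ (S : Finset (GridEdge m)) i, Sum.inr (Sum.inr i) ∈ S →
      Sum.inr (Sum.inr !i) ∈ S.map (reflectEdge m).toEmbedding := fun S i hi =>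
    Finset.mem_map_of_mem (reflectEdge m).toEmbedding hi
  refine Finset.sum_involution (fun P _ => if ∃ i, Sum.inr (Sum.inr i) ∈ P.2 then
      (P.1.map (reflectEdge m).toEmbedding, P.2.map (reflectEdge m).toEmbedding) else
      (P.1.map (swapEdge m).toEmbedding, P.2.map (swapEdge m).toEmbedding)) ?_ ?_ ?_ ?_
  · intro P hP
    decide
  · intro P hP _
    split_ifs with h
    · obtain ⟨i, hi⟩ := h
      exact fun h => map_reflect_ne hP hi (congrArg Prod.snd h)
    · exact map_swap_ne hP
  · intro P hP
    split_ifs with h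
    · exact map_reflect_mem_treeForestPairs hP
    · exact map_swap_mem_treeForestPairs hP (not_exists.1 h)
  · intro P hP
    by_cases h : ∃ i, Sum.inr (Sum.inr i) ∈ P.2
    · obtain ⟨i, hi⟩ := h
      simp only [if_pos (⟨i, hi⟩ : ∃ i, Sum.inr (Sum.inr i) ∈ P.2)]
      rw [if_pos ⟨_, hrefl _ i hi⟩]
      simp only [map_map_of_involutive reflectEdge_involutive]
    · simp only [if_neg h]
      rw [if_neg]
      · simp only [map_map_of_involutive swapEdge_involutive]
      · rintro ⟨i, hi⟩
        exact h ⟨i, (Finset.mem_map' (swapEdge m).toEmbedding (a := Sum.inr (Sum.inr i))).1 hi⟩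

/-- The parity which governs the zero count of the Kirchhoff polynomial. -/
lemma sum_grid_eq_zero (m : ℕ) :
    ∑ y, (treeDet (gridMatrix m) y none + (1 + treeDet (gridMatrix m) y none) *
      (forestDet (gridMatrix m) y (some (0, 1)) (some (Fin.last _, 1)) none +
        forestDet (gridMatrix m) y (some (Fin.last _, 1)) (some (0, 1)) none +
        forestDet (gridMatrix m) y none (some (0, 1)) (some (Fin.last _, 1)))) = 0 := by
  have htree : ∀ y, treeDet (gridMatrix m) (y ∘ reflectEdge m) none =
      treeDet (gridMatrix m) y none := fun y => by
    conv_lhs => rw [← gridMatrix_reflect, treeDet_submatrix]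
    rfl
  have hforest : ∀ y, forestDet (gridMatrix m) (y ∘ reflectEdge m) (some (0, 1))
      (some (Fin.last _, 1)) none =
      forestDet (gridMatrix m) y (some (Fin.last _, 1)) (some (0, 1)) none := fun y => by
    conv_lhs => rw [← gridMatrix_reflect, forestDet_submatrix]
    simp [reflectVertex]
  have hsymm : ∑ y, (1 + treeDet (gridMatrix m) y none) *
      forestDet (gridMatrix m) y (some (0, 1)) (some (Fin.last _, 1)) none =
      ∑ y, (1 + treeDet (gridMatrix m) y none) *
        forestDet (gridMatrix m) y (some (Fin.last _, 1)) (some (0, 1)) none := by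
    rw [← ((reflectEdge m).arrowCongr (Equiv.refl (ZMod 2))).symm.sum_comp]
    refine Finset.sum_congr rfl fun y _ => ?_
    rw [← hforest, ← htree y]
    rfl
  have hpairs := sum_treeDet_mul_forestDet (gridSource m) (gridTarget m) none
    (p := none) (r := some (Fin.last _, 1)) (some (0, 1)) (by simp)
  rw [Finset.sum_boole] at hpairs
  simp only [mul_add, Finset.sum_add_distrib]
  rw [hsymm, CharTwo.add_self_eq_zero, zero_add]
  simp_rw [add_mul, one_mul]
  rw [Finset.sum_add_distrib, sum_treeDet ⟨some (0, 0), by simp⟩,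
    sum_forestDet (by simp) ⟨some (0, 0), by simp⟩, hpairs, zero_add, zero_add]
  exact card_treeForestPairs m

end GridSum

section Torus

variable {m : ℕ}

/-- The position in the torus of a vertex other than the removed one, relative to the latter. -/
def torusPosition (m : ℕ) : Option (GridVertex m) → ZMod (m + 3) × ZMod 3
  | none => (0, 1)
  | some none => (0, 2)
  | some (some (i, j)) => ((Fin.succ i : Fin (m + 3)), j)

/-- First endpoints of the edges of the decompleted torus. -/
abbrev torusSource (m : ℕ) : GridEdge m ⊕ Fin 3 → Option (GridVertex m) :=
  starSource (gridSource m)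

/-- Second endpoints of the edges of the decompleted torus. -/
abbrev torusTarget (m : ℕ) : GridEdge m ⊕ Fin 3 → Option (GridVertex m) :=
  starTarget (gridTarget m) (some (0, 1)) (some (Fin.last _, 1)) none

lemma cycleGraph'_adj_add {n : ℕ} (x a b : ZMod n) :
    (cycleGraph' n).Adj (x + a) (x + b) ↔ (cycleGraph' n).Adj a b := by
  simp [cycleGraph']

lemma cycleGraph'_adj_iff (a b : Fin (m + 3)) : (cycleGraph' (m + 3)).Adj a b ↔
    (a : ℕ) + 1 = b ∨ (b : ℕ) + 1 = a ∨ (a : ℕ) = 0 ∧ (b : ℕ) = m + 2 ∨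
      (b : ℕ) = 0 ∧ (a : ℕ) = m + 2 := by
  have h : ∀ a b : Fin (m + 3), a - b = 1 ↔ (b : ℕ) + 1 = a ∨ (a : ℕ) = 0 ∧ (b : ℕ) = m + 2 := by
    intro a b
    rw [show a - b = 1 ↔ a = b + 1 by rw [sub_eq_iff_eq_add']]
    have ha := a.2
    have hb := b.2
    rw [Fin.ext_iff, Fin.val_add_one]
    simp only [Fin.ext_iff, Fin.val_last]
    split_ifs <;> omega
  have key : (cycleGraph' (m + 3)).Adj a b ↔ a ≠ b ∧ (a - b = 1 ∨ b - a = 1) :=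
    SimpleGraph.fromRel_adj _ _ _
  rw [key, h, h, ne_eq, Fin.ext_iff]
  omega

lemma cycleGraph'_three_adj_iff (a b : ZMod 3) : (cycleGraph' 3).Adj a b ↔ a ≠ b := by
  rw [cycleGraph', SimpleGraph.fromRel_adj]
  revert a b
  decide

lemma torusPosition_injective : Function.Injective (torusPosition m) := by
  have h12 : (1 : ZMod 3) ≠ 2 := by decide
  rintro (_ | _ | ⟨i, j⟩) (_ | _ | ⟨i', j'⟩) h
  · rfl
  · exact absurd (congrArg Prod.snd h) h12
  · exact absurd (congrArg Prod.fst h).symm (Fin.succ_ne_zero i')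
  · exact absurd (congrArg Prod.snd h).symm h12
  · rfl
  · exact absurd (congrArg Prod.fst h).symm (Fin.succ_ne_zero i')
  · exact absurd (congrArg Prod.fst h) (Fin.succ_ne_zero i)
  · exact absurd (congrArg Prod.fst h) (Fin.succ_ne_zero i)
  · obtain rfl : i = i' := Fin.succ_injective _ (congrArg Prod.fst h)
    obtain rfl : j = j' := congrArg Prod.snd h
    rfl

lemma exists_torusPosition_eq {p : ZMod (m + 3) × ZMod 3} (hp : p ≠ 0) :
    ∃ a, torusPosition m a = p := by
  obtain ⟨x, j⟩ := p
  change Fin (m + 3) at x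
  cases x using Fin.cases with
  | zero =>
    rcases (by decide : ∀ j : ZMod 3, j = 0 ∨ j = 1 ∨ j = 2) j with rfl | rfl | rfl
    · exact absurd rfl hp
    · exact ⟨none, rfl⟩
    · exact ⟨some none, rfl⟩
  | succ i => exact ⟨some (some (i, j)), rfl⟩

lemma torusPosition_ne_zero (a : Option (GridVertex m)) : torusPosition m a ≠ 0 := by
  rcases a with (_ | _ | ⟨i, j⟩) <;> intro h
  · exact absurd (congrArg Prod.snd h) (by decide : (1 : ZMod 3) ≠ 0)
  · exact absurd (congrArg Prod.snd h) (by decide : (2 : ZMod 3) ≠ 0)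
  · exact Fin.succ_ne_zero i (congrArg Prod.fst h)

lemma adj_torusPosition (e : GridEdge m ⊕ Fin 3) :
    ((cycleGraph' (m + 3)).boxProd (cycleGraph' 3)).Adj (torusPosition m (torusSource m e))
      (torusPosition m (torusTarget m e)) := by
  rw [SimpleGraph.boxProd_adj]
  rcases e with (⟨i, j⟩ | ⟨i, j⟩ | (_ | _)) | i
  · exact Or.inr ⟨(cycleGraph'_three_adj_iff _ _).2
      ((by decide : ∀ j : ZMod 3, j + 1 ≠ j + 2) j), rfl⟩
  · exact Or.inl ⟨(cycleGraph'_adj_iff i.castSucc.succ i.succ.succ).2 (by simp), rfl⟩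
  · exact Or.inl ⟨(cycleGraph'_adj_iff 0 (Fin.succ 0)).2 (by simp), rfl⟩
  · exact Or.inl ⟨(cycleGraph'_adj_iff 0 (Fin.last _).succ).2 (by simp), rfl⟩
  · fin_cases i
    · exact Or.inl ⟨(cycleGraph'_adj_iff 0 (Fin.succ 0)).2 (by simp), rfl⟩
    · exact Or.inl ⟨(cycleGraph'_adj_iff 0 (Fin.last _).succ).2 (by simp), rfl⟩
    · exact Or.inr ⟨(cycleGraph'_three_adj_iff _ _).2 (by decide : (1 : ZMod 3) ≠ 2), rfl⟩

lemma exists_torusEdge_of_adj {a b : Option (GridVertex m)}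
    (h : ((cycleGraph' (m + 3)).boxProd (cycleGraph' 3)).Adj (torusPosition m a)
      (torusPosition m b)) : ∃ e, s(torusSource m e, torusTarget m e) = s(a, b) := by
  have first : ∀ i : Fin (m + 2), (cycleGraph' (m + 3)).Adj (0 : Fin (m + 3)) i.succ →
      i = 0 ∨ i = Fin.last _ := by
    intro i hi
    rw [cycleGraph'_adj_iff] at hi
    simp only [Fin.ext_iff, Fin.val_last, Fin.val_succ, Fin.val_zero] at hi ⊢
    omega
  have succ : ∀ i i' : Fin (m + 2), (cycleGraph' (m + 3)).Adj i.succ i'.succ →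
      ∃ l : Fin (m + 1), i = l.castSucc ∧ i' = l.succ ∨ i = l.succ ∧ i' = l.castSucc := by
    intro i i' hi
    rw [cycleGraph'_adj_iff] at hi
    simp only [Fin.ext_iff, Fin.val_castSucc, Fin.val_succ] at hi ⊢
    have h1 := i.2
    have h2 := i'.2
    refine ⟨⟨min i i', by omega⟩, ?_⟩
    dsimp only
    omega
  have third : ∀ j j' : ZMod 3, j ≠ j' →
      ∃ l, j = l + 1 ∧ j' = l + 2 ∨ j = l + 2 ∧ j' = l + 1 := by decide
  have fromNone : ∀ b, ((cycleGraph' (m + 3)).boxProd (cycleGraph' 3)).Adj (torusPosition m none)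
      (torusPosition m b) → ∃ e, s(torusSource m e, torusTarget m e) = s(none, b) := by
    rintro (_ | _ | ⟨i, j⟩) h
    · exact absurd h (SimpleGraph.irrefl _)
    · exact ⟨Sum.inr 2, rfl⟩
    · rw [SimpleGraph.boxProd_adj] at h
      rcases h with ⟨h, hj⟩ | ⟨-, h⟩
      · obtain rfl : 1 = j := hj
        obtain rfl | rfl := first i h
        · exact ⟨Sum.inr 0, rfl⟩
        · exact ⟨Sum.inr 1, rfl⟩
      · exact absurd h.symm (Fin.succ_ne_zero i)
  have fromSomeNone : ∀ (i : Fin (m + 2)) (j : ZMod 3),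
      ((cycleGraph' (m + 3)).boxProd (cycleGraph' 3)).Adj (torusPosition m (some none))
        (torusPosition m (some (some (i, j)))) →
      ∃ e, s(torusSource m e, torusTarget m e) = s(some none, some (some (i, j))) := by
    intro i j h
    rw [SimpleGraph.boxProd_adj] at h
    rcases h with ⟨h, hj⟩ | ⟨-, h⟩
    · obtain rfl : 2 = j := hj
      obtain rfl | rfl := first i h
      · exact ⟨Sum.inl (Sum.inr (Sum.inr false)), rfl⟩
      · exact ⟨Sum.inl (Sum.inr (Sum.inr true)), rfl⟩
    · exact absurd h.symm (Fin.succ_ne_zero i)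
  rcases a with (_ | _ | ⟨i, j⟩)
  · exact fromNone b h
  · rcases b with (_ | _ | ⟨i', j'⟩)
    · rw [Sym2.eq_swap]
      exact fromNone _ h.symm
    · exact absurd h (SimpleGraph.irrefl _)
    · exact fromSomeNone _ _ h
  · rcases b with (_ | _ | ⟨i', j'⟩)
    · rw [Sym2.eq_swap]
      exact fromNone _ h.symm
    · rw [Sym2.eq_swap]
      exact fromSomeNone _ _ h.symm
    · rw [SimpleGraph.boxProd_adj] at h
      rcases h with ⟨h, hj⟩ | ⟨h, hi⟩
      · obtain rfl : j = j' := hj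
        obtain ⟨l, ⟨rfl, rfl⟩ | ⟨rfl, rfl⟩⟩ := succ i i' h
        · exact ⟨Sum.inl (Sum.inr (Sum.inl (l, j))), rfl⟩
        · exact ⟨Sum.inl (Sum.inr (Sum.inl (l, j))), Sym2.eq_swap⟩
      · obtain rfl : i = i' := Fin.succ_injective _ hi
        obtain ⟨l, ⟨rfl, rfl⟩ | ⟨rfl, rfl⟩⟩ :=
          third j j' ((cycleGraph'_three_adj_iff j j').1 h)
        · exact ⟨Sum.inl (Sum.inl (i, l)), rfl⟩
        · exact ⟨Sum.inl (Sum.inl (i, l)), Sym2.eq_swap⟩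

lemma torusEdge_injective :
    Function.Injective fun e => s(torusSource m e, torusTarget m e) := by
  have layer : ∀ j j' : ZMod 3, j + 1 = j' + 2 → j + 2 ≠ j' + 1 := by decide
  have layer_ne : ∀ j : ZMod 3, j + 1 ≠ j + 2 := by decide
  have h12 : (1 : ZMod 3) ≠ 2 := by decide
  have hlast : Fin.last (m + 1) ≠ 0 := Fin.last_pos.ne'
  have row : ∀ i i' : Fin (m + 1), i.castSucc = i'.succ → i.succ ≠ i'.castSucc := by
    intro i i' h h'
    simp only [Fin.ext_iff, Fin.val_castSucc, Fin.val_succ] at h h'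
    omega
  intro e e' h
  simp only [Sym2.eq_iff] at h
  rcases e with (⟨i, j⟩ | ⟨i, j⟩ | (_ | _)) | i <;>
    rcases e' with (⟨i', j'⟩ | ⟨i', j'⟩ | (_ | _)) | i' <;>
    try fin_cases i
  all_goals try fin_cases i'
  all_goals
    simp [starSource, starTarget, gridSource, gridTarget, h12, h12.symm, hlast, hlast.symm] at h ⊢
  all_goals grind

/-- The vertices of the decompleted torus. -/
noncomputable def torusVertexEquiv (v : ZMod (m + 3) × ZMod 3) :
    Option (GridVertex m) ≃ {w // w ∈ {w | w ≠ v}} :=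
  Equiv.ofBijective (fun a => ⟨v + torusPosition m a, by simp [torusPosition_ne_zero]⟩)
    ⟨fun a b h => torusPosition_injective (add_left_cancel (congrArg Subtype.val h)),
      fun w => by
        obtain ⟨a, ha⟩ := exists_torusPosition_eq (sub_ne_zero.2 w.2)
        exact ⟨a, Subtype.ext (by simp [ha])⟩⟩

lemma adj_torusVertexEquiv_iff (v : ZMod (m + 3) × ZMod 3) (a b : Option (GridVertex m)) :
    (((cycleGraph' (m + 3)).boxProd (cycleGraph' 3)).induce {w | w ≠ v}).Adj
        (torusVertexEquiv v a) (torusVertexEquiv v b) ↔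
      ((cycleGraph' (m + 3)).boxProd (cycleGraph' 3)).Adj (torusPosition m a)
        (torusPosition m b) := by
  change ((cycleGraph' (m + 3)).boxProd (cycleGraph' 3)).Adj (v + torusPosition m a)
    (v + torusPosition m b) ↔ _
  simp only [SimpleGraph.boxProd_adj, Prod.fst_add, Prod.snd_add, cycleGraph'_adj_add,
    add_right_inj]

/-- The edges of the decompleted torus. -/
noncomputable def torusEdgeEquiv (v : ZMod (m + 3) × ZMod 3) : GridEdge m ⊕ Fin 3 ≃
    (((cycleGraph' (m + 3)).boxProd (cycleGraph' 3)).induce {w | w ≠ v}).edgeSet :=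
  Equiv.ofBijective
    (fun e => ⟨s(torusVertexEquiv v (torusSource m e), torusVertexEquiv v (torusTarget m e)),
      (adj_torusVertexEquiv_iff v _ _).2 (adj_torusPosition e)⟩)
    ⟨fun e e' h => torusEdge_injective
        (Sym2.map.injective (torusVertexEquiv v).injective (congrArg Subtype.val h)), by
      rintro ⟨z, hz⟩
      induction z using Sym2.ind with
      | _ x y =>
        obtain ⟨a, rfl⟩ := (torusVertexEquiv v).surjective x
        obtain ⟨b, rfl⟩ := (torusVertexEquiv v).surjective y
        obtain ⟨e, he⟩ := exists_torusEdge_of_adj ((adj_torusVertexEquiv_iff v a b).1 hz)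
        exact ⟨e, Subtype.ext (congrArg (Sym2.map (torusVertexEquiv v)) he)⟩⟩

lemma eval_kirchhoff_torus (v : ZMod (m + 3) × ZMod 3)
    (x : (((cycleGraph' (m + 3)).boxProd (cycleGraph' 3)).induce {w | w ≠ v}).edgeSet → ZMod 2) :
    MvPolynomial.eval x (MvPolynomial.map (Int.castRingHom (ZMod 2))
        (kirchhoff (((cycleGraph' (m + 3)).boxProd (cycleGraph' 3)).induce {w | w ≠ v}))) =
      treeDet (incidence (torusSource m) (torusTarget m)) (x ∘ torusEdgeEquiv v) none := by
  have hB : (incidence (torusVertexEquiv v ∘ torusSource m)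
      (torusVertexEquiv v ∘ torusTarget m)).submatrix (Equiv.refl _) (torusVertexEquiv v) =
      incidence (torusSource m) (torusTarget m) := incidence_submatrix fun _ => rfl
  rw [eval_kirchhoff_eq_treeDet (s := torusVertexEquiv v ∘ torusSource m)
    (t := torusVertexEquiv v ∘ torusTarget m) (torusEdgeEquiv v) (fun _ => rfl)
    (torusVertexEquiv v none)]
  exact (treeDet_submatrix _ _ (Equiv.refl _) _ _).symm.trans (by rw [hB]; rfl)

end Torus

/-- For a decompleted toroidal grid built from 3-cycles, `[Ψ_G]_2 ≡ 0 (mod 8)`, i.e.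
`c₂^{(2)}(G) = 0`. -/
theorem c2_two_decompleted_3_torus_eq_zero (k : ℕ) [NeZero k] (hk : 3 ≤ k) (v : ZMod k × ZMod 3) :
    zeroCount (((cycleGraph' k).boxProd (cycleGraph' 3)).induce {w | w ≠ v}) 2 % 8 = 0 := by
  obtain ⟨m, rfl⟩ := Nat.exists_eq_add_of_le' hk
  have h : zeroCount (((cycleGraph' (m + 3)).boxProd (cycleGraph' 3)).induce {w | w ≠ v}) 2 =
      Nat.card {x : GridEdge m ⊕ Fin 3 → ZMod 2 //
        treeDet (incidence (torusSource m) (torusTarget m)) x none = 0} := by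
    refine Nat.card_congr (((torusEdgeEquiv v).symm.arrowCongr (Equiv.refl _)).subtypeEquiv ?_)
    intro x
    rw [eval_kirchhoff_torus]
    rfl
  rw [h]
  exact card_treeDet_star_zeros _ _ (by simp [Fin.last_pos.ne]) (by simp) (by simp)
    (sum_grid_eq_zero m)
end
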